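/- arXiv:0906.5023 — 2 statements merged into one kernel-verified Lean document; each statement's English description precedes it below -/
import Mathlib

section
/- For every m ∈ {4, 5, 6, 7, 8}, there exists an 8m-dimensional extremal even unimodular lattice L ⊂ ℝ^{8m} (i.e., an even unimodular lattice with minimum norm 2·⌊8m/24⌋ + 2) which contains a 12-frame, i.e., vectors f₁, …, f_{8m} ∈ L with ⟨fᵢ, fⱼ⟩ = 12·δ_{i,j} for all i, j. -/
open scoped BigOperators

/-- Euclidean weight of a word over `ℤ/mℤ`. -/
def euclWt {m : ℕ} {ι : Type*} [Fintype ι] (x : ι → ZMod m) : ℕ :=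
  ∑ i, min ((x i).val ^ 2) ((m - (x i).val) ^ 2)

/-- The dual code under the standard inner product. -/
def dualCode {m : ℕ} {ι : Type*} [Fintype ι]
    (C : Submodule (ZMod m) (ι → ZMod m)) : Set (ι → ZMod m) :=
  {x | ∀ y ∈ C, ∑ i, x i * y i = 0}

/-- A code is self-dual if it coincides with its dual code. -/
def IsSelfDualCode {m : ℕ} {ι : Type*} [Fintype ι]
    (C : Submodule (ZMod m) (ι → ZMod m)) : Prop :=
  (C : Set (ι → ZMod m)) = dualCode C

/-- A Type II `ℤ_{2k}`-code: self-dual with all Euclidean weights divisible by `4k`. -/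
def IsTypeII (k : ℕ) {ι : Type*} [Fintype ι]
    (C : Submodule (ZMod (2 * k)) (ι → ZMod (2 * k))) : Prop :=
  IsSelfDualCode C ∧ ∀ c ∈ C, 4 * k ∣ euclWt c

/-- The minimum Euclidean weight of a code. -/
noncomputable def minEuclWt {m : ℕ} {ι : Type*} [Fintype ι]
    (C : Submodule (ZMod m) (ι → ZMod m)) : ℕ :=
  sInf {w | ∃ c ∈ C, c ≠ 0 ∧ euclWt c = w}

/-- Standard inner product on `ι → ℝ`. -/
def ip {ι : Type*} [Fintype ι] (x y : ι → ℝ) : ℝ := ∑ i, x i * y i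

/-- A lattice: a discrete `ℤ`-submodule of `ℝ^ι` spanning it over `ℝ`. -/
def IsLatticeIn {ι : Type*} [Fintype ι] (L : Submodule ℤ (ι → ℝ)) : Prop :=
  DiscreteTopology L ∧ Submodule.span ℝ (L : Set (ι → ℝ)) = ⊤

/-- The dual lattice. -/
def dualLattice {ι : Type*} [Fintype ι] (L : Submodule ℤ (ι → ℝ)) : Set (ι → ℝ) :=
  {x | ∀ y ∈ L, ∃ z : ℤ, ip x y = (z : ℝ)}

/-- A lattice is unimodular if it equals its dual. -/
def IsUnimodularLattice {ι : Type*} [Fintype ι] (L : Submodule ℤ (ι → ℝ)) : Prop :=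
  (L : Set (ι → ℝ)) = dualLattice L

/-- A lattice is even if every vector has even integral norm. -/
def IsEvenLattice {ι : Type*} [Fintype ι] (L : Submodule ℤ (ι → ℝ)) : Prop :=
  ∀ x ∈ L, ∃ z : ℤ, ip x x = 2 * (z : ℝ)

/-- `r` is the minimum norm of the lattice `L`. -/
def HasMinNorm {ι : Type*} [Fintype ι] (L : Submodule ℤ (ι → ℝ)) (r : ℝ) : Prop :=
  IsLeast {t : ℝ | ∃ x ∈ L, x ≠ 0 ∧ ip x x = t} r

/-- Construction A: the set `(1/√m)·{x ∈ ℤ^ι : (x mod m) ∈ C}`. -/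
def constructionA (m : ℕ) {ι : Type*} [Fintype ι] (C : Set (ι → ZMod m)) :
    Set (ι → ℝ) :=
  {v | ∃ x : ι → ℤ, (fun i => (x i : ZMod m)) ∈ C ∧
    v = fun i => (x i : ℝ) / Real.sqrt m}

/-- A negacirculant matrix. -/
def IsNegacirculant {m : ℕ} {R : Type*} [CommRing R] (A : Matrix (Fin m) (Fin m) R) : Prop :=
  ∃ r : Fin m → R, ∀ i j : Fin m,
    A i j = if h : (i : ℕ) ≤ (j : ℕ) then r ⟨(j : ℕ) - (i : ℕ), by have := j.isLt; omega⟩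
      else - r ⟨m + (j : ℕ) - (i : ℕ), by have := i.isLt; have := j.isLt; omega⟩

section Lattice

variable {ι : Type*} [Fintype ι]

/-- Integer vectors that reduce modulo `3` into `C` and modulo `4` into the Klemm code. -/
def intLattice (C : Submodule (ZMod 3) (ι → ZMod 3)) : Submodule ℤ (ι → ℤ) where
  carrier := {x | (fun i => (x i : ZMod 3)) ∈ C ∧ (∃ a : ℤ, ∀ i, 2 ∣ x i - a) ∧ 4 ∣ ∑ i, x i}
  zero_mem' :=
    ⟨by simp only [Pi.zero_apply, Int.cast_zero]; exact C.zero_mem, ⟨0, by simp⟩, by simp⟩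
  add_mem' := by
    rintro x y ⟨hx, ⟨a, ha⟩, hx'⟩ ⟨hy, ⟨b, hb⟩, hy'⟩
    refine ⟨?_, ⟨a + b, fun i => ?_⟩, ?_⟩
    · have := C.add_mem hx hy
      convert this using 1
      ext i
      simp
    · have := dvd_add (ha i) (hb i)
      rwa [← add_sub_add_comm] at this
    · simpa [Finset.sum_add_distrib] using dvd_add hx' hy'
  smul_mem' := by
    rintro c x ⟨hx, ⟨a, ha⟩, hx'⟩
    refine ⟨?_, ⟨c * a, fun i => ?_⟩, ?_⟩
    · have := C.smul_mem (c : ZMod 3) hx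
      convert this using 1
      ext i
      simp
    · have := (ha i).mul_left c
      rwa [mul_sub] at this
    · simpa [Finset.mul_sum] using hx'.mul_left c

/-- Division of integer vectors by `√12`. -/
noncomputable def scaleHom (ι : Type*) : (ι → ℤ) →ₗ[ℤ] (ι → ℝ) where
  toFun x i := (x i : ℝ) / √12
  map_add' x y := by ext i; simp [add_div]
  map_smul' c x := by ext i; simp [mul_div_assoc]

/-- The real lattice obtained from a ternary code by gluing with the Klemm code. -/
noncomputable def codeLattice (C : Submodule (ZMod 3) (ι → ZMod 3)) : Submodule ℤ (ι → ℝ) :=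
  (intLattice C).map (scaleHom ι)

theorem ip_scaleHom (x y : ι → ℤ) :
    ip (scaleHom ι x) (scaleHom ι y) = ((∑ i, x i * y i : ℤ) : ℝ) / 12 := by
  have h : (√12 : ℝ) * √12 = 12 := Real.mul_self_sqrt (by norm_num)
  simp only [ip, scaleHom, LinearMap.coe_mk, AddHom.coe_mk, Int.cast_sum, Finset.sum_div,
    Int.cast_mul]
  refine Finset.sum_congr rfl fun i _ => ?_
  rw [div_mul_div_comm, h]

/-- A code is self-dual when it is its own orthogonal complement. -/
theorem mem_iff_of_isSelfDualCode {m : ℕ} {C : Submodule (ZMod m) (ι → ZMod m)}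
    (hC : IsSelfDualCode C) (x : ι → ZMod m) : x ∈ C ↔ ∀ y ∈ C, ∑ i, x i * y i = 0 :=
  Set.ext_iff.mp hC x

theorem twelve_dvd_sum_mul {C : Submodule (ZMod 3) (ι → ZMod 3)} (hC : IsSelfDualCode C)
    (hn : 8 ∣ Fintype.card ι) {x y : ι → ℤ} (hx : x ∈ intLattice C) (hy : y ∈ intLattice C) :
    12 ∣ ∑ i, x i * y i := by
  obtain ⟨hx, ⟨a, ha⟩, hx'⟩ := hx
  obtain ⟨hy, ⟨b, hb⟩, hy'⟩ := hy
  have h3 : (3 : ℤ) ∣ ∑ i, x i * y i := by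
    have := (mem_iff_of_isSelfDualCode hC _).1 hx _ hy
    refine (ZMod.intCast_zmod_eq_zero_iff_dvd _ 3).1 ?_
    simpa using this
  have h4 : (4 : ℤ) ∣ ∑ i, x i * y i := by
    have h : (4 : ℤ) ∣ ∑ i, (x i - a) * (y i - b) :=
      Finset.dvd_sum fun i _ => mul_dvd_mul (ha i) (hb i)
    have hn' : (4 : ℤ) ∣ Fintype.card ι := by
      have : 4 ∣ Fintype.card ι := (by norm_num : 4 ∣ 8).trans hn
      exact_mod_cast this
    have e : ∑ i, x i * y i = ∑ i, (x i - a) * (y i - b) + b * ∑ i, x i + a * ∑ i, y i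
        - Fintype.card ι * (a * b) := by
      simp only [sub_mul, mul_sub, Finset.sum_sub_distrib, Finset.mul_sum, Finset.sum_const,
        Finset.card_univ, nsmul_eq_mul]
      simp only [mul_comm b]
      ring
    rw [e]
    exact dvd_sub (dvd_add (dvd_add h (hx'.mul_left _)) (hy'.mul_left _)) (hn'.mul_right _)
  exact IsCoprime.mul_dvd (by norm_num : IsCoprime (3 : ℤ) 4) h3 h4

theorem twentyFour_dvd_sum_mul_self {C : Submodule (ZMod 3) (ι → ZMod 3)}
    (hC : IsSelfDualCode C) (hn : 8 ∣ Fintype.card ι) {x : ι → ℤ} (hx : x ∈ intLattice C) :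
    24 ∣ ∑ i, x i * x i := by
  have h3 : (3 : ℤ) ∣ ∑ i, x i * x i :=
    (by norm_num : (3 : ℤ) ∣ 12).trans (twelve_dvd_sum_mul hC hn hx hx)
  obtain ⟨-, ⟨a, ha⟩, hx'⟩ := hx
  have h8 : (8 : ℤ) ∣ ∑ i, x i * x i := by
    have h : (8 : ℤ) ∣ ∑ i, (x i - a) * (x i - a - 2) := Finset.dvd_sum fun i _ => by
      obtain ⟨t, ht⟩ := ha i
      obtain ⟨s, hs⟩ := Int.even_mul_pred_self t
      rw [ht]
      exact ⟨s, by linear_combination 4 * hs⟩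
    have hn' : (8 : ℤ) ∣ Fintype.card ι := by exact_mod_cast hn
    have e : ∑ i, x i * x i = ∑ i, (x i - a) * (x i - a - 2) + (a + 1) * (2 * ∑ i, x i)
        - Fintype.card ι * (a * (a + 2)) := by
      have : ∀ i, x i * x i = (x i - a) * (x i - a - 2) + (a + 1) * (2 * x i) - a * (a + 2) :=
        fun i => by ring
      rw [Finset.sum_congr rfl fun i _ => this i]
      simp [Finset.sum_sub_distrib, Finset.sum_add_distrib, Finset.mul_sum]
    have h8' : (8 : ℤ) ∣ 2 * ∑ i, x i := mul_dvd_mul_left 2 hx'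
    rw [e]
    exact dvd_sub (dvd_add h (h8'.mul_left _)) (hn'.mul_right _)
  exact IsCoprime.mul_dvd (by norm_num : IsCoprime (3 : ℤ) 8) h3 h8

theorem isEvenLattice_codeLattice {C : Submodule (ZMod 3) (ι → ZMod 3)} (hC : IsSelfDualCode C)
    (hn : 8 ∣ Fintype.card ι) : IsEvenLattice (codeLattice C) := by
  rintro _ ⟨x, hx, rfl⟩
  obtain ⟨z, hz⟩ := twentyFour_dvd_sum_mul_self hC hn hx
  refine ⟨z, ?_⟩
  rw [ip_scaleHom, hz]
  push_cast
  ring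

variable [DecidableEq ι]

theorem single_twelve_mem (C : Submodule (ZMod 3) (ι → ZMod 3)) (i : ι) :
    Pi.single i 12 ∈ intLattice C := by
  refine ⟨?_, ⟨0, fun j => ?_⟩, ?_⟩
  · convert C.zero_mem using 1
    ext j
    obtain rfl | h := eq_or_ne j i
    · simpa using (by decide : (12 : ZMod 3) = 0)
    · simp [h]
  · obtain rfl | h := eq_or_ne j i
    · simp
    · simp [h]
  · simp

theorem isLatticeIn_codeLattice (C : Submodule (ZMod 3) (ι → ZMod 3)) :
    IsLatticeIn (codeLattice C) := by
  have h0 : (√12 : ℝ) ≠ 0 := by positivity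
  constructor
  · let b : Module.Basis ι ℝ (ι → ℝ) :=
      (Pi.basisFun ℝ ι).isUnitSMul (w := fun _ => (√12)⁻¹) fun _ => (inv_ne_zero h0).isUnit
    have hsub : (codeLattice C : Set (ι → ℝ)) ⊆ Submodule.span ℤ (Set.range b) := by
      rintro _ ⟨x, -, rfl⟩
      have : scaleHom ι x = ∑ i, x i • b i := by
        ext j
        simp [scaleHom, b, Module.Basis.isUnitSMul_apply, Finset.sum_apply, Pi.single_apply,
          div_eq_inv_mul]
      rw [this]
      exact Submodule.sum_mem _ fun i _ =>
        Submodule.smul_mem _ _ (Submodule.subset_span ⟨i, rfl⟩)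
    have : DiscreteTopology (Submodule.span ℤ (Set.range b)) := inferInstance
    exact DiscreteTopology.of_subset this hsub
  · rw [eq_top_iff, ← (Pi.basisFun ℝ ι).span_eq, Submodule.span_le]
    rintro _ ⟨i, rfl⟩
    have hmem : scaleHom ι (Pi.single i 12) ∈ codeLattice C :=
      ⟨_, single_twelve_mem C i, rfl⟩
    have : (Pi.basisFun ℝ ι) i = (√12 / 12 : ℝ) • scaleHom ι (Pi.single i 12) := by
      ext j
      obtain rfl | h := eq_or_ne j i
      · simp [scaleHom, field]
      · simp [scaleHom, h]
    rw [this]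
    exact Submodule.smul_mem _ _ (Submodule.subset_span hmem)

theorem sum_mul_single_sub_single {R : Type*} [CommRing R] (w : ι → R) (c : R) (i j : ι) :
    ∑ k, w k * (Pi.single i c - Pi.single j c : ι → R) k = c * (w i - w j) := by
  simp [mul_sub, Finset.sum_sub_distrib, Pi.single_apply, mul_comm c, sub_mul]

theorem isUnimodularLattice_codeLattice {C : Submodule (ZMod 3) (ι → ZMod 3)}
    (hC : IsSelfDualCode C) (hn : 8 ∣ Fintype.card ι) :
    IsUnimodularLattice (codeLattice C) := by
  have h0 : (√12 : ℝ) ≠ 0 := by positivity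
  have hsq : (√12 : ℝ) * √12 = 12 := Real.mul_self_sqrt (by norm_num)
  apply Set.Subset.antisymm
  · rintro _ ⟨x, hx, rfl⟩ _ ⟨y, hy, rfl⟩
    obtain ⟨z, hz⟩ := twelve_dvd_sum_mul hC hn hx hy
    refine ⟨z, ?_⟩
    rw [ip_scaleHom, hz]
    push_cast
    ring
  · intro v hv
    have hint : ∀ i, ∃ z : ℤ, v i * √12 = z := fun i => by
      obtain ⟨z, hz⟩ := hv _ ⟨_, single_twelve_mem C i, rfl⟩
      refine ⟨z, ?_⟩
      rw [← hz, ip, Finset.sum_eq_single i (fun j _ h => by simp [scaleHom, h]) (by simp)]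
      simp only [scaleHom, LinearMap.coe_mk, AddHom.coe_mk, Pi.single_eq_same, Int.cast_ofNat]
      field_simp
      rw [sq, hsq]
    choose w hw using hint
    have hvw : scaleHom ι w = v := by
      ext i
      simp only [scaleHom, LinearMap.coe_mk, AddHom.coe_mk, ← hw]
      field_simp
    have hdvd : ∀ y ∈ intLattice C, (12 : ℤ) ∣ ∑ i, w i * y i := fun y hy => by
      obtain ⟨z, hz⟩ := hv _ ⟨y, hy, rfl⟩
      rw [← hvw, ip_scaleHom, div_eq_iff (by norm_num)] at hz
      refine ⟨z, ?_⟩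
      rw [mul_comm]
      exact_mod_cast hz
    refine ⟨w, ⟨?_, ?_, ?_⟩, hvw⟩
    · rw [mem_iff_of_isSelfDualCode hC]
      intro c hc
      have hc4 : ∀ i, ((4 * ((c i).val : ℤ) : ℤ) : ZMod 3) = c i := fun i => by
        have h4 : (4 : ZMod 3) = 1 := by decide
        simp [h4]
      have hy : (fun i => 4 * ((c i).val : ℤ)) ∈ intLattice C := by
        refine ⟨by simpa only [hc4] using hc, ⟨0, fun i => ?_⟩, ?_⟩
        · dsimp only; omega
        · rw [← Finset.mul_sum]; exact dvd_mul_right _ _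
      have h3 := (by norm_num : (3 : ℤ) ∣ 12).trans (hdvd _ hy)
      have := (ZMod.intCast_zmod_eq_zero_iff_dvd _ 3).2 h3
      rw [Int.cast_sum] at this
      simpa only [Int.cast_mul _ (4 * _), hc4] using this
    · obtain hι | ⟨⟨i₀⟩⟩ := isEmpty_or_nonempty ι
      · exact ⟨0, fun i => hι.elim i⟩
      refine ⟨w i₀, fun i => ?_⟩
      have hy : (Pi.single i 6 - Pi.single i₀ 6 : ι → ℤ) ∈ intLattice C := by
        have h6 : ∀ j k : ι, ∃ z : ℤ, (Pi.single j 6 : ι → ℤ) k = 6 * z := fun j k => by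
          obtain rfl | h := eq_or_ne k j
          · exact ⟨1, by simp⟩
          · exact ⟨0, by simp [h]⟩
        refine ⟨?_, ⟨0, fun k => ?_⟩, ?_⟩
        · convert C.zero_mem using 1
          ext k
          obtain ⟨z, hz⟩ := h6 i k
          obtain ⟨z', hz'⟩ := h6 i₀ k
          have : (6 : ZMod 3) = 0 := by decide
          simp [hz, hz', this]
        · obtain ⟨z, hz⟩ := h6 i k
          obtain ⟨z', hz'⟩ := h6 i₀ k
          rw [Pi.sub_apply, hz, hz']
          omega
        · simp
      have h := hdvd _ hy
      rw [sum_mul_single_sub_single] at h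
      omega
    · have hy : (fun _ => 3 : ι → ℤ) ∈ intLattice C := by
        refine ⟨?_, ⟨1, fun _ => by norm_num⟩, ?_⟩
        · convert C.zero_mem using 1
          ext i
          simpa using (by decide : (3 : ZMod 3) = 0)
        · have : (4 : ℤ) ∣ Fintype.card ι := by
            have : 4 ∣ Fintype.card ι := (by norm_num : 4 ∣ 8).trans hn
            exact_mod_cast this
          simpa using this.mul_right 3
      have h := hdvd _ hy
      rw [← Finset.sum_mul] at h
      omega

end Lattice

section Minimum

variable {ι : Type*} [Fintype ι]

theorem lt_sum_mul_self {C : Submodule (ZMod 3) (ι → ZMod 3)} (hC : IsSelfDualCode C)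
    (hn : 8 ∣ Fintype.card ι) {d : ℕ} (hd : d ≤ 12) (hwt : ∀ c ∈ C, c ≠ 0 → d < hammingNorm c)
    (hodd : ∀ x ∈ intLattice C, (∀ i, Odd (x i)) → 4 * (d : ℤ) < ∑ i, x i * x i)
    {x : ι → ℤ} (hx : x ∈ intLattice C) (hx0 : x ≠ 0) : 4 * (d : ℤ) < ∑ i, x i * x i := by
  have h24 := twentyFour_dvd_sum_mul_self hC hn hx
  have ⟨hxC, ⟨a, ha⟩, _⟩ := hx
  obtain h | h := Int.even_or_odd a
  swap
  · exact hodd x hx fun i => by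
      obtain ⟨b, rfl⟩ := h
      obtain ⟨t, ht⟩ := ha i
      exact ⟨t + b, by linarith⟩
  by_contra! hle
  have hev : ∀ i, ∃ y, x i = 2 * y := fun i => by
    obtain ⟨b, rfl⟩ := h
    obtain ⟨t, ht⟩ := ha i
    exact ⟨t + b, by linarith⟩
  choose y hy using hev
  have hsum : ∑ i, x i * x i = 4 * ∑ i, y i * y i := by
    rw [Finset.mul_sum]
    exact Finset.sum_congr rfl fun i _ => by rw [hy]; ring
  have hzero : (fun i => (x i : ZMod 3)) = 0 := by
    by_contra hne
    have h1 := hwt _ hxC hne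
    have h2 : ((hammingNorm fun i => (x i : ZMod 3) : ℕ) : ℤ) ≤ ∑ i, y i * y i := by
      rw [hammingNorm, Finset.card_filter, Nat.cast_sum]
      refine Finset.sum_le_sum fun i _ => ?_
      split_ifs with hi
      · have : y i ≠ 0 := by rintro h; simp [hy, h] at hi
        have := mul_self_pos.2 this
        push_cast
        omega
      · exact_mod_cast mul_self_nonneg (y i)
    omega
  have hz : ∀ i, ∃ z, x i = 6 * z := fun i => by
    have h3 := (ZMod.intCast_zmod_eq_zero_iff_dvd (x i) 3).1 (congrFun hzero i)
    have := hy i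
    exact ⟨x i / 6, by omega⟩
  choose z hz using hz
  have hsum' : ∑ i, x i * x i = 36 * ∑ i, z i * z i := by
    rw [Finset.mul_sum]
    exact Finset.sum_congr rfl fun i _ => by rw [hz]; ring
  have hnn : 0 ≤ ∑ i, z i * z i := Finset.sum_nonneg fun i _ => mul_self_nonneg _
  have h0 : ∑ i, z i * z i = 0 := by omega
  refine hx0 (funext fun i => ?_)
  have := (Finset.sum_eq_zero_iff_of_nonneg fun i _ => mul_self_nonneg (z i)).1 h0 i
    (Finset.mem_univ i)
  simp [hz, mul_self_eq_zero.1 this]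

theorem hasMinNorm_codeLattice {C : Submodule (ZMod 3) (ι → ZMod 3)} (hC : IsSelfDualCode C)
    (hn : 8 ∣ Fintype.card ι) {d : ℕ} (hd : d ≤ 12) (hd6 : 6 ∣ d)
    (hwt : ∀ c ∈ C, c ≠ 0 → d < hammingNorm c)
    (hodd : ∀ x ∈ intLattice C, (∀ i, Odd (x i)) → 4 * (d : ℤ) < ∑ i, x i * x i)
    (hex : ∃ x ∈ intLattice C, ∑ i, x i * x i = 4 * d + 24) :
    HasMinNorm (codeLattice C) (d / 3 + 2) := by
  constructor
  · obtain ⟨x, hx, hsum⟩ := hex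
    refine ⟨_, ⟨x, hx, rfl⟩, ?_, ?_⟩
    · intro h0
      have h := ip_scaleHom x x
      rw [h0, hsum] at h
      simp only [ip, Pi.zero_apply, mul_zero, Finset.sum_const_zero] at h
      push_cast at h
      have : (0 : ℝ) ≤ d := d.cast_nonneg
      linarith
    · rw [ip_scaleHom, hsum]
      push_cast
      ring
  · rintro _ ⟨_, ⟨x, hx, rfl⟩, hx0, rfl⟩
    have hx0' : x ≠ 0 := by
      rintro rfl
      exact hx0 (map_zero _)
    have h1 := lt_sum_mul_self hC hn hd hwt hodd hx hx0'
    have h2 := twentyFour_dvd_sum_mul_self hC hn hx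
    have h3 : 4 * (d : ℤ) + 24 ≤ ∑ i, x i * x i := by omega
    have h4 : (4 * d + 24 : ℝ) ≤ ((∑ i, x i * x i : ℤ) : ℝ) := by exact_mod_cast h3
    rw [ip_scaleHom]
    linarith

/-- A Hadamard matrix of order four. -/
def hadamardFour : Matrix (Fin 4) (Fin 4) ℤ :=
  !![1, 1, 1, 1; 1, -1, 1, -1; 1, 1, -1, -1; 1, -1, -1, 1]

theorem hadamardFour_mul_transpose : hadamardFour * hadamardFour.transpose = 4 := by
  decide

open scoped Kronecker in
theorem exists_twelve_frame [DecidableEq ι] {q : ℕ} (e : ι ≃ Fin q × Fin 4)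
    (C : Submodule (ZMod 3) (ι → ZMod 3)) :
    ∃ f : ι → ι → ℝ, (∀ i, f i ∈ codeLattice C) ∧
      ∀ i j, ip (f i) (f j) = if i = j then 12 else 0 := by
  let K : Matrix (Fin q × Fin 4) (Fin q × Fin 4) ℤ := 1 ⊗ₖ hadamardFour
  have hK : K * K.transpose = (4 : Matrix (Fin q × Fin 4) (Fin q × Fin 4) ℤ) := by
    have : (4 : Matrix (Fin 4) (Fin 4) ℤ) = (4 : ℤ) • 1 := by decide
    change (1 ⊗ₖ hadamardFour) * (1 ⊗ₖ hadamardFour).transpose = 4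
    rw [← Matrix.kroneckerMap_transpose, ← Matrix.mul_kronecker_mul, hadamardFour_mul_transpose,
      Matrix.transpose_one, one_mul, this, Matrix.kronecker_smul, Matrix.one_kronecker_one]
    rw [zsmul_eq_mul, mul_one]
    rfl
  refine ⟨fun i => scaleHom ι fun j => 6 * K (e i) (e j), fun i => ⟨_, ⟨?_, ⟨0, ?_⟩, ?_⟩, rfl⟩,
    fun i j => ?_⟩
  · convert C.zero_mem using 1
    ext j
    have : (6 : ZMod 3) = 0 := by decide
    simp [this]
  · intro j
    omega
  · rw [← Finset.mul_sum, e.sum_comp (fun p => K (e i) p), Fintype.sum_prod_type,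
      Finset.sum_eq_single (e i).1 (fun a _ h => by simp [K, Matrix.one_apply_ne h.symm]) (by simp)]
    have : ∀ b : Fin 4, (4 : ℤ) ∣ 6 * ∑ c, hadamardFour b c := by decide
    simpa [K] using this (e i).2
  · have h := congrFun (congrFun hK (e i)) (e j)
    rw [Matrix.mul_apply, ← e.sum_comp] at h
    rw [ip_scaleHom]
    have h36 : ∑ k, 6 * K (e i) (e k) * (6 * K (e j) (e k)) = if i = j then 144 else 0 := by
      have : ∀ k, 6 * K (e i) (e k) * (6 * K (e j) (e k))
          = 36 * (K (e i) (e k) * K.transpose (e k) (e j)) := fun k => by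
        rw [Matrix.transpose_apply]
        ring
      rw [Finset.sum_congr rfl fun k _ => this k, ← Finset.mul_sum, h, Matrix.ofNat_apply]
      simp only [e.apply_eq_iff_eq]
      split_ifs <;> rfl
    rw [h36]
    split_ifs <;> norm_num

end Minimum

section Lanes

/-- Addition of residues modulo `3`, represented by signs. -/
def signAdd : SignType → SignType → SignType
  | .zero, b => b
  | .pos, .zero => .pos
  | .pos, .pos => .neg
  | .pos, .neg => .zero
  | .neg, .zero => .neg
  | .neg, .pos => .zero
  | .neg, .neg => .pos

/-- Bit masks over a family of lanes, each lane carrying a residue `v` modulo `3`: the mask with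
index `c` marks the lanes with `v + c ≠ 0`. -/
abbrev Planes := ℕ × ℕ × ℕ

def Planes.get (x : Planes) : SignType → ℕ
  | .zero => x.1
  | .pos => x.2.1
  | .neg => x.2.2

def Planes.ofFn (f : SignType → ℕ) : Planes := (f .zero, f .pos, f .neg)

/-- The number of lanes and the masks of all coordinates. -/
abbrev Block := ℕ × List Planes

/-- Concatenates the lanes of `x`, of `y` shifted by `a`, and of `y` shifted by `-a`. -/
def joinPlane (l l' : ℕ) (x y : Planes) (a : SignType) : Planes :=
  .ofFn fun c => Nat.lor (x.get c) (Nat.lor (Nat.shiftLeft (y.get (signAdd c a)) l)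
    (Nat.shiftLeft (y.get (signAdd c (-a))) l'))

def joinPlanes (l l' : ℕ) : List Planes → List Planes → List SignType → List Planes
  | x :: xs, y :: ys, a :: as => joinPlane l l' x y a :: joinPlanes l l' xs ys as
  | _, _, _ => []

def joinBlock (x y : Block) (r : List SignType) : Block :=
  (Nat.add x.1 (Nat.add y.1 y.1), joinPlanes x.1 (Nat.add x.1 y.1) x.2 y.2 r)

def stepTail (r : List SignType) : Block → List Block → List Block
  | _, [] => []
  | y, x :: t => joinBlock x y r :: stepTail r x t

/-- Passes from the table of the combinations of some rows, sorted by weight, to the table with the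
additional row `r`. -/
def stepTable (r : List SignType) : List Block → List Block
  | [] => []
  | x :: t => x :: stepTail r x t

def baseTable (n W : ℕ) : List Block :=
  (1, List.replicate n (0, 1, 1)) :: List.replicate W (0, List.replicate n (0, 0, 0))

/-- Annotates every suffix of a list of rows by its table. -/
def buildStack {T : Type} (step : List SignType → T → T) (B : T) :
    List (List SignType) → List (List SignType × T)
  | [] => []
  | r :: rs => match buildStack step B rs with
    | [] => [(r, step r B)]
    | (r', t) :: st => (r, step r t) :: (r', t) :: st

/-- Adds one bit per coordinate to the saturating counter with binary digits `c0`, …, `c4`, and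
returns the mask of the lanes that are saturated in the end. -/
def countLanes : List Planes → List SignType → ℕ → ℕ → ℕ → ℕ → ℕ → ℕ
  | x :: xs, s :: ss, c0, c1, c2, c3, c4 =>
    let t0 := x.get s
    let t1 := Nat.land c0 t0
    let t2 := Nat.land c1 t1
    let t3 := Nat.land c2 t2
    let t4 := Nat.land c3 t3
    countLanes xs ss (Nat.xor c0 t0) (Nat.xor c1 t1) (Nat.xor c2 t2) (Nat.xor c3 t3)
      (Nat.lor c4 t4)
  | _, _, _, _, _, _, c4 => c4

/-- Checks that adding `s` to any word of the block gives at least `thr` nonzero coordinates. -/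
def checkBlock (thr : ℕ) (s : List SignType) (b : Block) : Bool :=
  let mask := Nat.sub (Nat.pow 2 b.1) 1
  let digit := fun j => bif Nat.testBit (Nat.sub 16 thr) j then mask else 0
  Nat.beq (countLanes b.2 s (digit 0) (digit 1) (digit 2) (digit 3) 0) mask

def checkTable (thr : ℕ) (s : List SignType) : List Block → ℕ → Bool
  | [], _ => false
  | b :: _, 0 => checkBlock thr s b
  | _ :: t, w + 1 => checkTable thr s t w

/-- Checks the combinations of weight `w`, where at most `d` of the rows are chosen one at a time
before the tables are used. -/
def checkStack (B : List Block) (thr : ℕ) :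
    List (List SignType × List Block) → ℕ → ℕ → List SignType → Bool
  | [], _, 0, s => checkTable thr s B 0
  | [], _, _ + 1, _ => true
  | (r, _) :: st, d + 1, w + 1, s =>
    checkStack B thr st (d + 1) (w + 1) s && checkStack B thr st d w (List.zipWith signAdd s r) &&
      checkStack B thr st d w (List.zipWith signAdd s (r.map Neg.neg))
  | (_, T) :: _, 0, w, s => checkTable thr s T w
  | (_, T) :: _, _ + 1, 0, s => checkTable thr s T 0

/-- Checks that `s + ∑ uᵢ rᵢ` has at least `d - wt u` nonzero coordinates when `wt u < t`. -/
def checkWeights (s : List SignType) (rows : List (List SignType)) (d t : ℕ) : Bool :=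
  let B := baseTable s.length 4
  let S := buildStack stepTable B rows
  (List.range t).all fun a => checkStack B (Nat.sub d a) S (Nat.sub a 4) a s

/-- The number of lanes, the masks of all coordinates, and the masks of the lanes with negative and
positive product of the coefficients. -/
abbrev SignBlock := ℕ × List Planes × ℕ × ℕ

def doublePlane (l : ℕ) (x : Planes) (a : SignType) : Planes :=
  .ofFn fun c => Nat.lor (x.get (signAdd c a)) (Nat.shiftLeft (x.get (signAdd c (-a))) l)

def doubleBlock (r : List SignType) (b : SignBlock) : SignBlock :=
  (Nat.add b.1 b.1, List.zipWith (doublePlane b.1) b.2.1 r,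
    Nat.lor b.2.2.1 (Nat.shiftLeft b.2.2.2 b.1), Nat.lor b.2.2.2 (Nat.shiftLeft b.2.2.1 b.1))

def baseSignBlock (n : ℕ) : SignBlock := (1, List.replicate n (0, 1, 1), 0, 1)

def checkSigns : List Planes → List SignType → ℕ → ℕ → Bool
  | x :: xs, s :: ss, nz, par =>
    checkSigns xs ss (Nat.land nz (x.get s)) (Nat.xor par (x.get (signAdd s .neg)))
  | _, _, nz, par => Nat.beq (Nat.land nz par) nz

def checkSignBlock (e : Bool) (s : List SignType) (b : SignBlock) : Bool :=
  checkSigns b.2.1 s (Nat.lor b.2.2.1 b.2.2.2) (bif e then b.2.2.2 else b.2.2.1)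

def checkSignStack (B : SignBlock) :
    List (List SignType × SignBlock) → ℕ → Bool → List SignType → Bool
  | [], _, e, s => checkSignBlock e s B
  | (_, T) :: _, 0, e, s => checkSignBlock e s T
  | (r, _) :: st, d + 1, e, s => checkSignStack B st d e (List.zipWith signAdd s r) &&
      checkSignStack B st d (!e) (List.zipWith signAdd s (r.map Neg.neg))

/-- Checks that all words `s + ∑ uᵢ rᵢ` without zero coordinate, where every `uᵢ` is a sign, have
an odd number of negative coordinates, those of `u` included. -/
def checkFullWeight (s : List SignType) (rows : List (List SignType)) : Bool :=
  let B := baseSignBlock s.length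
  checkSignStack B (buildStack doubleBlock B rows) 5 false s

end Lanes

section Words

theorem cast_signAdd : ∀ a b : SignType, ((signAdd a b : SignType) : ZMod 3) = a + b := by decide

theorem cast_neg_sign : ∀ a : SignType, ((-a : SignType) : ZMod 3) = -a := by decide

/-- The word over the integers modulo `3` given by a list of signs. -/
def signWord (r : List SignType) (j : ℕ) : ZMod 3 := (r.getD j 0 : SignType)

theorem signWord_zipWith_signAdd {s r : List SignType} (h : s.length = r.length) :
    signWord (List.zipWith signAdd s r) = signWord s + signWord r := by
  ext j
  simp only [signWord, Pi.add_apply, List.getD_eq_getElem?_getD, List.getElem?_zipWith]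
  by_cases hj : j < s.length
  · rw [List.getElem?_eq_getElem hj, List.getElem?_eq_getElem (h ▸ hj)]
    exact cast_signAdd _ _
  · rw [List.getElem?_eq_none (not_lt.1 hj), List.getElem?_eq_none (h ▸ not_lt.1 hj)]
    simp

theorem signWord_map_neg (r : List SignType) : signWord (r.map Neg.neg) = -signWord r := by
  ext j
  simp only [signWord, Pi.neg_apply, List.getD_eq_getElem?_getD, List.getElem?_map]
  cases r[j]?
  · rfl
  · exact cast_neg_sign _

/-- `IsComb rows t w` says that `w` is a linear combination of `rows` with `t` nonzero
coefficients. -/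
inductive IsComb : List (List SignType) → ℕ → (ℕ → ZMod 3) → Prop
  | nil : IsComb [] 0 0
  | skip {rows t w} (r : List SignType) (h : IsComb rows t w) : IsComb (r :: rows) t w
  | add {rows t w} (r : List SignType) (h : IsComb rows t w) :
      IsComb (r :: rows) (t + 1) (signWord r + w)
  | sub {rows t w} (r : List SignType) (h : IsComb rows t w) :
      IsComb (r :: rows) (t + 1) (-signWord r + w)

/-- The number of nonzero coordinates among the first `n`. -/
def weightBelow (n : ℕ) (w : ℕ → ZMod 3) : ℕ := ∑ j ∈ Finset.range n, if w j ≠ 0 then 1 else 0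

theorem Planes.get_ofFn (f : SignType → ℕ) (c : SignType) : (Planes.ofFn f).get c = f c := by
  cases c <;> rfl

/-- Lane `i` of the masks `xs` carries the word `w`. -/
def IsLane (xs : List Planes) (i : ℕ) (w : ℕ → ZMod 3) : Prop :=
  ∀ j x, xs[j]? = some x → ∀ c : SignType, (x.get c).testBit i = decide (w j + c ≠ 0)

/-- The masks of the block have length `n`, and every word of `P` is carried by some lane. -/
structure IsBlock (n : ℕ) (P : (ℕ → ZMod 3) → Prop) (b : Block) : Prop where
  length_eq : b.2.length = n
  get_lt : ∀ x ∈ b.2, ∀ c, x.get c < 2 ^ b.1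
  exists_lane : ∀ w, P w → ∃ i < b.1, IsLane b.2 i w

theorem length_joinPlanes (l l' : ℕ) : ∀ (xs ys : List Planes) (r : List SignType),
    xs.length = r.length → ys.length = r.length → (joinPlanes l l' xs ys r).length = r.length
  | [], _, r, h, _ => by simpa [joinPlanes] using h
  | _ :: _, [], r, _, h => by simpa [joinPlanes] using h
  | _ :: _, _ :: _, [], h, _ => by simp at h
  | x :: xs, y :: ys, a :: r, h, h' => by
    simpa [joinPlanes] using length_joinPlanes l l' xs ys r (by simpa using h) (by simpa using h')

theorem exists_of_getElem?_joinPlanes (l l' : ℕ) {z : Planes} :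
    ∀ {xs ys : List Planes} {r : List SignType} {j : ℕ}, (joinPlanes l l' xs ys r)[j]? = some z →
      ∃ x y a, xs[j]? = some x ∧ ys[j]? = some y ∧ r[j]? = some a ∧ z = joinPlane l l' x y a
  | [], _, _, _, h => by simp [joinPlanes] at h
  | _ :: _, [], _, _, h => by simp [joinPlanes] at h
  | _ :: _, _ :: _, [], _, h => by simp [joinPlanes] at h
  | x :: xs, y :: ys, a :: r, 0, h => ⟨x, y, a, by simp_all [joinPlanes]⟩
  | x :: xs, y :: ys, a :: r, j + 1, h => by
    simpa using exists_of_getElem?_joinPlanes l l' (xs := xs) (ys := ys) (r := r) (j := j)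
      (by simpa [joinPlanes] using h)

theorem get_joinPlane (l l' : ℕ) (x y : Planes) (a c : SignType) :
    (joinPlane l l' x y a).get c =
      x.get c ||| (y.get (signAdd c a) <<< l ||| y.get (signAdd c (-a)) <<< l') :=
  Planes.get_ofFn _ c

theorem shiftLeft_lt {x k : ℕ} (l : ℕ) (h : x < 2 ^ k) : x <<< l < 2 ^ (l + k) := by
  rw [Nat.shiftLeft_eq, pow_add, mul_comm]
  exact Nat.mul_lt_mul_of_pos_left h (by positivity)

theorem signWord_of_getElem? {r : List SignType} {j : ℕ} {a : SignType} (h : r[j]? = some a) :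
    signWord r j = a := by
  simp [signWord, h]

theorem IsBlock.join {n : ℕ} {P Q R : (ℕ → ZMod 3) → Prop} {x y : Block} (hx : IsBlock n P x)
    (hy : IsBlock n Q y) {r : List SignType} (hr : r.length = n)
    (hR : ∀ w, R w → P w ∨ ∃ w', Q w' ∧ (w = signWord r + w' ∨ w = -signWord r + w')) :
    IsBlock n R (joinBlock x y r) where
  length_eq := by
    rw [← hr]
    exact length_joinPlanes _ _ _ _ _ (hx.1.trans hr.symm) (hy.1.trans hr.symm)
  get_lt z hz c := by
    obtain ⟨j, hj⟩ := List.getElem?_of_mem hz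
    obtain ⟨x', y', a, hx', hy', -, rfl⟩ := exists_of_getElem?_joinPlanes _ _ hj
    have hxl := hx.get_lt x' (List.mem_of_getElem? hx')
    have hyl := hy.get_lt y' (List.mem_of_getElem? hy')
    rw [get_joinPlane]
    change _ < 2 ^ (x.1 + (y.1 + y.1))
    refine Nat.or_lt_two_pow ((hxl c).trans_le ?_) (Nat.or_lt_two_pow
      ((shiftLeft_lt x.1 (hyl _)).trans_le ?_) ?_)
    · exact Nat.pow_le_pow_right (by norm_num) (by omega)
    · exact Nat.pow_le_pow_right (by norm_num) (by omega)
    · rw [← add_assoc]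
      exact shiftLeft_lt (x.1 + y.1) (hyl _)
  exists_lane w hw := by
    have key : ∀ {i j : ℕ} {z : Planes} {c : SignType}, (joinBlock x y r).2[j]? = some z →
        ∃ (x' y' : Planes) (a : SignType), x.2[j]? = some x' ∧ y.2[j]? = some y' ∧
          signWord r j = a ∧ (z.get c).testBit i = ((x'.get c).testBit i ||
          (decide (x.1 ≤ i) && (y'.get (signAdd c a)).testBit (i - x.1) ||
          decide (x.1 + y.1 ≤ i) && (y'.get (signAdd c (-a))).testBit (i - (x.1 + y.1)))) := by
      intro i j z c hz
      obtain ⟨x', y', a, hx', hy', ha, rfl⟩ := exists_of_getElem?_joinPlanes _ _ hz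
      refine ⟨x', y', a, hx', hy', signWord_of_getElem? ha, ?_⟩
      rw [get_joinPlane, Nat.testBit_or, Nat.testBit_or, Nat.testBit_shiftLeft,
        Nat.testBit_shiftLeft]
      rfl
    have high : ∀ {b : Block} {P}, IsBlock n P b → ∀ {j i : ℕ} {z : Planes} {c : SignType},
        b.2[j]? = some z → b.1 ≤ i → (z.get c).testBit i = false := fun hb _ _ _ _ hz hi =>
      Nat.testBit_lt_two_pow ((hb.get_lt _ (List.mem_of_getElem? hz) _).trans_le
        (Nat.pow_le_pow_right (by norm_num) hi))
    obtain hw | ⟨w', hw', rfl | rfl⟩ := hR w hw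
    · obtain ⟨i, hi, hl⟩ := hx.exists_lane w hw
      refine ⟨i, show i < x.1 + (y.1 + y.1) by omega, fun j z hz c => ?_⟩
      obtain ⟨x', y', a, hx', hy', ha, h⟩ := key (i := i) (c := c) hz
      rw [h, hl j x' hx', decide_eq_false (by omega : ¬ x.1 ≤ i),
        decide_eq_false (by omega : ¬ x.1 + y.1 ≤ i)]
      simp
    · obtain ⟨i, hi, hl⟩ := hy.exists_lane w' hw'
      refine ⟨x.1 + i, show x.1 + i < x.1 + (y.1 + y.1) by omega, fun j z hz c => ?_⟩
      obtain ⟨x', y', a, hx', hy', ha, h⟩ := key (i := x.1 + i) (c := c) hz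
      rw [h, high hx hx' (by omega), decide_eq_false (by omega : ¬ x.1 + y.1 ≤ x.1 + i),
        Nat.add_sub_cancel_left, hl j y' hy', Pi.add_apply, ha, cast_signAdd]
      simp [add_comm, add_left_comm]
    · obtain ⟨i, hi, hl⟩ := hy.exists_lane w' hw'
      refine ⟨x.1 + y.1 + i, show _ < x.1 + (y.1 + y.1) by omega, fun j z hz c => ?_⟩
      obtain ⟨x', y', a, hx', hy', ha, h⟩ := key (i := x.1 + y.1 + i) (c := c) hz
      rw [h, high hx hx' (by omega), high hy hy' (by omega), Nat.add_sub_cancel_left, hl j y' hy',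
        Pi.add_apply, Pi.neg_apply, ha, cast_signAdd, cast_neg_sign]
      simp [add_comm, add_left_comm]

end Words

section Tables

/-- The block with index `t` in the table consists of the combinations of weight `t`. -/
def IsTable (n : ℕ) (rows : List (List SignType)) (T : List Block) : Prop :=
  ∀ t b, T[t]? = some b → IsBlock n (IsComb rows t) b

theorem isTable_baseTable (n W : ℕ) : IsTable n [] (baseTable n W) := by
  rintro (_ | t) b hb
  · obtain rfl : (1, List.replicate n (0, 1, 1)) = b := by simpa [baseTable] using hb
    refine ⟨by simp, fun x hx c => ?_, fun w hw => ⟨0, by simp, fun j x hx c => ?_⟩⟩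
    · obtain rfl := List.eq_of_mem_replicate hx
      exact (by decide : ∀ c, Planes.get (0, 1, 1) c < 2) c
    · obtain rfl := List.eq_of_mem_replicate (List.mem_of_getElem? hx)
      cases hw
      exact (by decide : ∀ c : SignType, (Planes.get (0, 1, 1) c).testBit 0 =
        decide ((0 : ZMod 3) + c ≠ 0)) c
  · have hb' : b = (0, List.replicate n (0, 0, 0)) := by
      simp only [baseTable, List.getElem?_cons_succ] at hb
      exact List.eq_of_mem_replicate (List.mem_of_getElem? hb)
    subst hb'
    refine ⟨by simp, fun x hx c => ?_, fun w hw => by cases hw⟩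
    obtain rfl := List.eq_of_mem_replicate hx
    exact (by decide : ∀ c, Planes.get (0, 0, 0) c < 1) c

theorem exists_of_getElem?_stepTail {r : List SignType} {b : Block} :
    ∀ {T : List Block} {y : Block} {t : ℕ}, (stepTail r y T)[t]? = some b →
      ∃ x y', T[t]? = some x ∧ (y :: T)[t]? = some y' ∧ b = joinBlock x y' r
  | [], _, _, h => by simp [stepTail] at h
  | x :: T, y, 0, h => ⟨x, y, by simp_all [stepTail]⟩
  | x :: T, y, t + 1, h => by
    simpa using exists_of_getElem?_stepTail (T := T) (y := x) (t := t)
      (by simpa [stepTail] using h)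

theorem IsTable.step {n : ℕ} {rows : List (List SignType)} {T : List Block}
    (hT : IsTable n rows T) {r : List SignType} (hr : r.length = n) :
    IsTable n (r :: rows) (stepTable r T) := by
  intro t b hb
  cases T with
  | nil => simp [stepTable] at hb
  | cons x T =>
    cases t with
    | zero =>
      obtain rfl : x = b := by simpa [stepTable] using hb
      have hx := hT 0 x rfl
      refine ⟨hx.1, hx.2, fun w hw => hx.3 w ?_⟩
      cases hw
      assumption
    | succ t =>
      obtain ⟨x', y', hx', hy', rfl⟩ :=
        exists_of_getElem?_stepTail (T := T) (y := x) (t := t) (by simpa [stepTable] using hb)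
      refine (hT (t + 1) x' (by simpa using hx')).join (hT t y' hy') hr fun w hw => ?_
      cases hw with
      | skip _ h => exact .inl h
      | add _ h => exact .inr ⟨_, h, .inl rfl⟩
      | sub _ h => exact .inr ⟨_, h, .inr rfl⟩

/-- Every suffix of the rows is annotated by an object that satisfies `Q`. -/
def IsStack {T : Type} (n : ℕ) (Q : List (List SignType) → T → Prop) :
    List (List SignType × T) → Prop
  | [] => True
  | (r, t) :: st => r.length = n ∧ Q (r :: st.map Prod.fst) t ∧ IsStack n Q st

theorem buildStack_spec {T : Type} {n : ℕ} {Q : List (List SignType) → T → Prop}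
    {step : List SignType → T → T} {B : T} (hB : Q [] B)
    (hstep : ∀ r rows t, r.length = n → Q rows t → Q (r :: rows) (step r t)) :
    ∀ rows : List (List SignType), (∀ r ∈ rows, r.length = n) →
      IsStack n Q (buildStack step B rows) ∧ (buildStack step B rows).map Prod.fst = rows
  | [], _ => ⟨trivial, rfl⟩
  | r :: rows, h => by
    obtain ⟨h1, h2⟩ := buildStack_spec hB hstep rows fun r hr => h r (List.mem_cons_of_mem _ hr)
    have hr := h r List.mem_cons_self
    rw [buildStack]
    rcases hs : buildStack step B rows with _ | ⟨⟨r', t⟩, st⟩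
    · rw [hs] at h2
      obtain rfl : [] = rows := by simpa using h2
      exact ⟨⟨hr, hstep _ _ _ hr hB, trivial⟩, rfl⟩
    · rw [hs] at h1 h2
      refine ⟨⟨hr, ?_, h1⟩, ?_⟩
      · obtain ⟨-, h3, -⟩ := h1
        rw [List.map_cons]
        exact hstep _ _ _ hr h3
      · rw [List.map_cons, h2]

/-- The bit of the counter `c0`, …, `c4` together with the bits to be added bounds the outcome. -/
theorem countLanes_le (i : ℕ) : ∀ (xs : List Planes) (ss : List SignType) (c0 c1 c2 c3 c4 : ℕ),
    16 * ((countLanes xs ss c0 c1 c2 c3 c4).testBit i).toNat ≤ (c0.testBit i).toNat +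
      2 * (c1.testBit i).toNat + 4 * (c2.testBit i).toNat + 8 * (c3.testBit i).toNat +
      16 * (c4.testBit i).toNat +
      (List.zipWith (fun x s => ((Planes.get x s).testBit i).toNat) xs ss).sum
  | x :: xs, s :: ss, c0, c1, c2, c3, c4 => by
    have ih := countLanes_le i xs ss
    have hand : ∀ a b, Nat.testBit (Nat.land a b) i = (a.testBit i && b.testBit i) :=
      fun a b => Nat.testBit_and a b i
    have hor : ∀ a b, Nat.testBit (Nat.lor a b) i = (a.testBit i || b.testBit i) :=
      fun a b => Nat.testBit_or a b i
    have hxor : ∀ a b, Nat.testBit (Nat.xor a b) i = (a.testBit i ^^ b.testBit i) :=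
      fun a b => Nat.testBit_xor a b i
    rw [countLanes]
    refine (ih _ _ _ _ _).trans ?_
    simp only [hand, hor, hxor, List.zipWith_cons_cons, List.sum_cons]
    cases (x.get s).testBit i <;> cases c0.testBit i <;> cases c1.testBit i <;>
      cases c2.testBit i <;> cases c3.testBit i <;> cases c4.testBit i <;>
      simp <;> omega
  | [], _, c0, c1, c2, c3, c4 => by
    simp only [countLanes, List.zipWith_nil_left, List.sum_nil]
    omega
  | _ :: _, [], c0, c1, c2, c3, c4 => by
    simp only [countLanes, List.zipWith_nil_right, List.sum_nil]
    omega

theorem sum_zipWith_eq_weightBelow {i : ℕ} : ∀ {xs : List Planes} {s : List SignType}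
    {w : ℕ → ZMod 3}, IsLane xs i w → xs.length = s.length →
    (List.zipWith (fun x s => ((Planes.get x s).testBit i).toNat) xs s).sum =
      weightBelow s.length (signWord s + w)
  | [], s, w, _, h => by
    obtain rfl : s = [] := List.eq_nil_of_length_eq_zero h.symm
    simp [weightBelow]
  | x :: xs, [], _, _, h => by simp at h
  | x :: xs, a :: s, w, hl, h => by
    have ih := sum_zipWith_eq_weightBelow (xs := xs) (s := s) (i := i) (w := fun j => w (j + 1))
      (fun j x hx => hl (j + 1) x (by simpa using hx)) (by simpa using h)
    have h0 := hl 0 x rfl a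
    rw [List.zipWith_cons_cons, List.sum_cons, ih, h0, weightBelow, weightBelow, List.length_cons,
      Finset.sum_range_succ']
    rw [add_comm]
    congr 1
    rw [add_comm (w 0)]
    by_cases h : (a : ZMod 3) + w 0 = 0 <;> simp [h, signWord]

theorem le_weightBelow_of_checkBlock {thr : ℕ} (hthr : thr ≤ 16) {s : List SignType} {b : Block}
    {P : (ℕ → ZMod 3) → Prop} (hb : IsBlock s.length P b) (h : checkBlock thr s b = true)
    {w : ℕ → ZMod 3} (hw : P w) : thr ≤ weightBelow s.length (signWord s + w) := by
  obtain ⟨i, hi, hl⟩ := hb.exists_lane w hw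
  have h1 := Nat.eq_of_beq_eq_true h
  have h2 := congrArg (fun m => 16 * (Nat.testBit m i).toNat) h1
  dsimp only at h2
  have hmask : Nat.testBit (Nat.sub (Nat.pow 2 b.1) 1) i = true := by
    simpa using (Nat.testBit_two_pow_sub_one b.1 i).trans (decide_eq_true hi)
  have h3 := countLanes_le i b.2 s
  rw [hmask] at h2
  rw [← sum_zipWith_eq_weightBelow hl hb.length_eq]
  have h4 := h2.symm.trans_le (h3 _ _ _ _ _)
  have hdigit : ∀ j, (Nat.testBit (bif Nat.testBit (Nat.sub 16 thr) j then
      Nat.sub (Nat.pow 2 b.1) 1 else 0) i) = Nat.testBit (16 - thr) j := fun j => by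
    change _ = Nat.testBit (Nat.sub 16 thr) j
    cases Nat.testBit (Nat.sub 16 thr) j
    · simp
    · simpa using hmask
  rw [hdigit, hdigit, hdigit, hdigit, Nat.zero_testBit] at h4
  have hlow : (Nat.testBit (16 - thr) 0).toNat + 2 * (Nat.testBit (16 - thr) 1).toNat +
      4 * (Nat.testBit (16 - thr) 2).toNat + 8 * (Nat.testBit (16 - thr) 3).toNat ≤ 16 - thr := by
    clear * - hthr
    interval_cases thr <;> decide
  simp only [Bool.toNat_true, Bool.toNat_false] at h4
  omega

theorem le_weightBelow_of_checkTable {n thr : ℕ} (hthr : thr ≤ 16) {s : List SignType}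
    (hs : s.length = n) {rows : List (List SignType)} {w : ℕ → ZMod 3} {t : ℕ}
    (hw : IsComb rows t w) {T : List Block} (hT : IsTable n rows T)
    (h : checkTable thr s T t = true) : thr ≤ weightBelow n (signWord s + w) := by
  have key : ∀ (T : List Block) t, checkTable thr s T t = true →
      ∃ b, T[t]? = some b ∧ checkBlock thr s b = true := by
    intro T
    induction T with
    | nil => intro t h; simp [checkTable] at h
    | cons b T ih =>
      rintro (_ | t) h
      · exact ⟨b, rfl, h⟩
      · simpa using ih t h
  obtain ⟨b, hb, hc⟩ := key T t h
  subst hs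
  exact le_weightBelow_of_checkBlock hthr (hT t b hb) hc hw

theorem le_weightBelow_of_checkStack {n thr : ℕ} (hthr : thr ≤ 16) {B : List Block}
    (hB : IsTable n [] B) : ∀ {st : List (List SignType × List Block)} {d t : ℕ}
    {s : List SignType} {w : ℕ → ZMod 3}, IsStack n (IsTable n) st → s.length = n →
    checkStack B thr st d t s = true → IsComb (st.map Prod.fst) t w →
      thr ≤ weightBelow n (signWord s + w)
  | [], _, 0, s, w, _, hs, h, hw => le_weightBelow_of_checkTable hthr hs hw hB h
  | [], _, t + 1, _, _, _, _, _, hw => by cases hw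
  | (r, T) :: st, d + 1, t + 1, s, w, hst, hs, h, hw => by
    obtain ⟨hr, -, hst⟩ := hst
    simp only [checkStack, Bool.and_eq_true] at h
    obtain ⟨⟨h1, h2⟩, h3⟩ := h
    cases hw with
    | skip _ hw => exact le_weightBelow_of_checkStack hthr hB hst hs h1 hw
    | add _ hw =>
      have := le_weightBelow_of_checkStack hthr hB hst (by simp [hs, hr]) h2 hw
      rwa [signWord_zipWith_signAdd (hs.trans hr.symm), add_assoc] at this
    | sub _ hw =>
      have := le_weightBelow_of_checkStack hthr hB hst (by simp [hs, hr]) h3 hw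
      rwa [signWord_zipWith_signAdd (by simp [hs, hr]), signWord_map_neg, add_assoc] at this
  | (r, T) :: st, 0, t, s, w, hst, hs, h, hw =>
    le_weightBelow_of_checkTable hthr hs hw hst.2.1 (by simpa [checkStack] using h)
  | (r, T) :: st, _ + 1, 0, s, w, hst, hs, h, hw =>
    le_weightBelow_of_checkTable hthr hs hw hst.2.1 (by simpa [checkStack] using h)

theorem le_weightBelow_of_checkWeights {s : List SignType} {rows : List (List SignType)}
    {d t : ℕ} (hd : d ≤ 16) (hrows : ∀ r ∈ rows, r.length = s.length)
    (h : checkWeights s rows d t = true) {a : ℕ} (ha : a < t) {w : ℕ → ZMod 3}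
    (hw : IsComb rows a w) : d ≤ a + weightBelow s.length (signWord s + w) := by
  have hB := isTable_baseTable s.length 4
  obtain ⟨h1, h2⟩ := buildStack_spec (step := stepTable) hB
    (fun r rows t hr ht => IsTable.step ht hr) rows hrows
  have h3 := List.all_eq_true.1 h a (List.mem_range.2 ha)
  have := le_weightBelow_of_checkStack (show d - a ≤ 16 by omega) hB h1 rfl h3 (by rwa [h2])
  omega

end Tables

section Signs

/-- `IsSignComb rows e w` says that `w` is a combination of `rows` with all coefficients `1` or
`-1`, the number of coefficients `-1` being odd if `e = true` and even if `e = false`. -/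
inductive IsSignComb : List (List SignType) → Bool → (ℕ → ZMod 3) → Prop
  | nil : IsSignComb [] false 0
  | add {rows e w} (r : List SignType) (h : IsSignComb rows e w) :
      IsSignComb (r :: rows) e (signWord r + w)
  | sub {rows e w} (r : List SignType) (h : IsSignComb rows e w) :
      IsSignComb (r :: rows) (!e) (-signWord r + w)

/-- The sign with the given parity, as an integer modulo `3`. -/
def paritySign (e : Bool) : ZMod 3 := bif e then -1 else 1

theorem paritySign_not : ∀ e, paritySign (!e) = -paritySign e := by decide

theorem paritySign_xor : ∀ e e', paritySign (e ^^ e') = paritySign e * paritySign e' := by decide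

theorem paritySign_ne_one : ∀ v : ZMod 3, v ≠ 0 → paritySign (decide (v + -1 ≠ 0)) = v := by decide

/-- Every signed combination of the rows is carried by some lane, with its parity. -/
structure IsSignBlock (n : ℕ) (rows : List (List SignType)) (b : SignBlock) : Prop where
  length_eq : b.2.1.length = n
  get_lt : ∀ x ∈ b.2.1, ∀ c, x.get c < 2 ^ b.1
  neg_lt : b.2.2.1 < 2 ^ b.1
  pos_lt : b.2.2.2 < 2 ^ b.1
  exists_lane : ∀ e w, IsSignComb rows e w → ∃ i < b.1, IsLane b.2.1 i w ∧
    b.2.2.1.testBit i = e ∧ b.2.2.2.testBit i = !e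

theorem isSignBlock_base (n : ℕ) : IsSignBlock n [] (baseSignBlock n) where
  length_eq := List.length_replicate
  get_lt x hx c := by
    obtain rfl := List.eq_of_mem_replicate hx
    exact (by decide : ∀ c, Planes.get (0, 1, 1) c < 2) c
  neg_lt := by simp [baseSignBlock]
  pos_lt := by simp [baseSignBlock]
  exists_lane e w hw := by
    cases hw
    refine ⟨0, Nat.one_pos, fun j x hx c => ?_, Nat.zero_testBit 0,
      (by decide : Nat.testBit 1 0 = !false)⟩
    obtain rfl := List.eq_of_mem_replicate (List.mem_of_getElem? hx)
    exact (by decide : ∀ c : SignType, (Planes.get (0, 1, 1) c).testBit 0 =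
      decide ((0 : ZMod 3) + c ≠ 0)) c

theorem get_doublePlane (l : ℕ) (x : Planes) (a c : SignType) :
    (doublePlane l x a).get c = x.get (signAdd c a) ||| x.get (signAdd c (-a)) <<< l :=
  Planes.get_ofFn _ c

theorem IsSignBlock.double {n : ℕ} {rows : List (List SignType)} {b : SignBlock}
    (hb : IsSignBlock n rows b) {r : List SignType} (hr : r.length = n) :
    IsSignBlock n (r :: rows) (doubleBlock r b) := by
  have split : ∀ {j z}, (doubleBlock r b).2.1[j]? = some z → ∃ (x : Planes) (a : SignType),
      b.2.1[j]? = some x ∧ signWord r j = a ∧ z = doublePlane b.1 x a := by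
    intro j z hz
    obtain ⟨x, a, hx, ha, rfl⟩ := List.getElem?_zipWith_eq_some.1 hz
    exact ⟨x, a, hx, signWord_of_getElem? ha, rfl⟩
  have hle : 2 ^ b.1 ≤ 2 ^ (b.1 + b.1) := Nat.pow_le_pow_right (by norm_num) (by omega)
  have low : ∀ {x y i : ℕ}, i < b.1 → (x ||| y <<< b.1).testBit i = x.testBit i :=
    fun h => by simp [Nat.testBit_or, Nat.testBit_shiftLeft, h]
  have high : ∀ {x y : ℕ} (i : ℕ), x < 2 ^ b.1 →
      (x ||| y <<< b.1).testBit (b.1 + i) = y.testBit i := by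
    intro x y i h
    have : x.testBit (b.1 + i) = false := Nat.testBit_lt_two_pow
      (h.trans_le (Nat.pow_le_pow_right (by norm_num) (by omega)))
    simp [Nat.testBit_or, Nat.testBit_shiftLeft, this]
  refine ⟨?_, fun z hz c => ?_, ?_, ?_, fun e w hw => ?_⟩
  · simp [doubleBlock, hb.length_eq, hr]
  · obtain ⟨j, hj⟩ := List.getElem?_of_mem hz
    obtain ⟨x, a, hx, -, rfl⟩ := split hj
    have hlt := hb.get_lt x (List.mem_of_getElem? hx)
    rw [get_doublePlane]
    exact Nat.or_lt_two_pow ((hlt _).trans_le hle) (shiftLeft_lt _ (hlt _))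
  · exact Nat.or_lt_two_pow (hb.neg_lt.trans_le hle) (shiftLeft_lt _ hb.pos_lt)
  · exact Nat.or_lt_two_pow (hb.pos_lt.trans_le hle) (shiftLeft_lt _ hb.neg_lt)
  · cases hw with
    | add _ h =>
      obtain ⟨i, hi, hl, h1, h2⟩ := hb.exists_lane _ _ h
      refine ⟨i, show i < b.1 + b.1 by omega, fun j z hz c => ?_, (low hi).trans h1,
        (low hi).trans h2⟩
      obtain ⟨x, a, hx, ha, rfl⟩ := split hz
      rw [get_doublePlane, low hi, hl j x hx, Pi.add_apply, ha, cast_signAdd]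
      simp [add_comm, add_left_comm]
    | sub _ h =>
      obtain ⟨i, hi, hl, h1, h2⟩ := hb.exists_lane _ _ h
      refine ⟨b.1 + i, show b.1 + i < b.1 + b.1 by omega, fun j z hz c => ?_,
        (high i hb.neg_lt).trans h2, (high i hb.pos_lt).trans (by rw [h1, Bool.not_not])⟩
      obtain ⟨x, a, hx, ha, rfl⟩ := split hz
      rw [get_doublePlane, high i (hb.get_lt x (List.mem_of_getElem? hx) _), hl j x hx,
        Pi.add_apply, Pi.neg_apply, ha, cast_signAdd, cast_neg_sign]
      simp [add_comm, add_left_comm]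

theorem prod_eq_of_checkSigns {i : ℕ} : ∀ {xs : List Planes} {s : List SignType} {w : ℕ → ZMod 3}
    {nz par : ℕ}, IsLane xs i w → xs.length = s.length → checkSigns xs s nz par = true →
    nz.testBit i = true → (∀ j < s.length, (signWord s + w) j ≠ 0) →
    paritySign (par.testBit i) * ∏ j ∈ Finset.range s.length, (signWord s + w) j = -1
  | [], s, w, nz, par, _, h, hc, hnz, _ => by
    obtain rfl : s = [] := List.eq_nil_of_length_eq_zero h.symm
    have h1 : nz &&& par = nz := Nat.eq_of_beq_eq_true hc
    have h2 := congrArg (Nat.testBit · i) h1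
    simp only [Nat.testBit_and, hnz, Bool.true_and] at h2
    simp [h2, paritySign]
  | x :: xs, [], _, _, _, _, h, _, _, _ => by simp at h
  | x :: xs, a :: s, w, nz, par, hl, h, hc, hnz, hw => by
    have h0 := hl 0 x rfl
    have hw0 : w 0 + a ≠ 0 := by
      have := hw 0 (by simp)
      rwa [Pi.add_apply, add_comm] at this
    have ih := prod_eq_of_checkSigns (xs := xs) (s := s) (i := i) (w := fun j => w (j + 1))
      (fun j x hx => hl (j + 1) x (by simpa using hx)) (by simpa using h) hc
      (by
        change (nz &&& x.get a).testBit i = true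
        rw [Nat.testBit_and, hnz, h0, decide_eq_true hw0]
        rfl)
      fun j hj => hw (j + 1) (by simpa using hj)
    have hpar : (Nat.xor par (x.get (signAdd a .neg))).testBit i =
        (par.testBit i ^^ decide (w 0 + a + -1 ≠ 0)) := by
      change (par ^^^ _).testBit i = _
      rw [Nat.testBit_xor, h0, cast_signAdd, add_assoc]
      rfl
    rw [hpar, paritySign_xor, paritySign_ne_one _ hw0] at ih
    rw [List.length_cons, Finset.prod_range_succ', ← ih]
    have : (signWord (a :: s) + w) 0 = w 0 + a := add_comm _ _
    rw [this, mul_comm (Finset.prod _ _), mul_assoc]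
    rfl

theorem prod_eq_of_checkSignBlock {n : ℕ} {rows : List (List SignType)} {b : SignBlock}
    (hb : IsSignBlock n rows b) {s : List SignType} (hs : s.length = n) {e e' : Bool}
    (h : checkSignBlock e s b = true) {w : ℕ → ZMod 3} (hw : IsSignComb rows e' w)
    (hnz : ∀ j < n, (signWord s + w) j ≠ 0) :
    paritySign e * paritySign e' * ∏ j ∈ Finset.range n, (signWord s + w) j = -1 := by
  subst hs
  obtain ⟨i, -, hl, h1, h2⟩ := hb.exists_lane e' w hw
  have := prod_eq_of_checkSigns hl hb.length_eq h
    (by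
      change (b.2.2.1 ||| b.2.2.2).testBit i = true
      simp [Nat.testBit_or, h1, h2]) hnz
  rw [← this, ← paritySign_xor]
  congr 2
  cases e <;> simp [h1, h2]

theorem prod_eq_of_checkSignStack {n : ℕ} {B : SignBlock} (hB : IsSignBlock n [] B) :
    ∀ {st : List (List SignType × SignBlock)} {d : ℕ} {e e' : Bool} {s : List SignType}
    {w : ℕ → ZMod 3}, IsStack n (IsSignBlock n) st → s.length = n →
    checkSignStack B st d e s = true → IsSignComb (st.map Prod.fst) e' w →
    (∀ j < n, (signWord s + w) j ≠ 0) →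
    paritySign e * paritySign e' * ∏ j ∈ Finset.range n, (signWord s + w) j = -1
  | [], d, e, e', s, w, _, hs, h, hw, hnz =>
    prod_eq_of_checkSignBlock hB hs (by simpa [checkSignStack] using h) hw hnz
  | (r, T) :: st, 0, e, e', s, w, hst, hs, h, hw, hnz =>
    prod_eq_of_checkSignBlock hst.2.1 hs h hw hnz
  | (r, T) :: st, d + 1, e, e', s, w, hst, hs, h, hw, hnz => by
    obtain ⟨hr, -, hst⟩ := hst
    simp only [checkSignStack, Bool.and_eq_true] at h
    obtain ⟨h1, h2⟩ := h
    cases hw with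
    | add _ hw =>
      have := prod_eq_of_checkSignStack hB hst (by simp [hs, hr]) h1 hw
      rw [signWord_zipWith_signAdd (hs.trans hr.symm), add_assoc] at this
      exact this hnz
    | sub _ hw =>
      have := prod_eq_of_checkSignStack hB hst (by simp [hs, hr]) h2 hw
      rw [signWord_zipWith_signAdd (by simp [hs, hr]), signWord_map_neg, add_assoc] at this
      rw [paritySign_not] at this ⊢
      refine Eq.trans ?_ (this hnz)
      simp only [mul_neg, neg_mul]

theorem prod_eq_of_checkFullWeight {s : List SignType} {rows : List (List SignType)}
    (hrows : ∀ r ∈ rows, r.length = s.length) (h : checkFullWeight s rows = true) {e : Bool}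
    {w : ℕ → ZMod 3} (hw : IsSignComb rows e w) (hnz : ∀ j < s.length, (signWord s + w) j ≠ 0) :
    paritySign e * ∏ j ∈ Finset.range s.length, (signWord s + w) j = -1 := by
  have hB := isSignBlock_base s.length
  obtain ⟨h1, h2⟩ := buildStack_spec (step := doubleBlock) hB
    (fun r rows t hr ht => IsSignBlock.double ht hr) rows hrows
  have := prod_eq_of_checkSignStack hB h1 rfl h (by rwa [h2]) hnz
  rwa [show paritySign false = 1 from rfl, one_mul] at this

end Signs

section Negacirculant

variable {m : ℕ}

/-- The negacirculant matrix of signs with first row `r`. -/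
def negacirculant (m : ℕ) (r : List SignType) : Matrix (Fin (m + 1)) (Fin (m + 1)) SignType :=
  .of fun i j => if (i : ℕ) ≤ j then r.getD (j - i) 0 else -r.getD (m + 1 + j - i) 0

/-- The rows of a matrix of signs, except for the first one. -/
def tailRows {n : ℕ} (a : Matrix (Fin (m + 1)) (Fin n) SignType) : List (List SignType) :=
  List.ofFn fun i : Fin m => List.ofFn (a i.succ)

/-- The matrix over the integers modulo `3` given by a matrix of signs. -/
def signMatrix {n : ℕ} (a : Matrix (Fin (m + 1)) (Fin n) SignType) :
    Matrix (Fin (m + 1)) (Fin n) (ZMod 3) :=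
  a.map fun s => (s : ZMod 3)

/-- Invariance of a square matrix under the negacyclic shift of rows and columns. -/
structure IsNegacyclic {R : Type*} [Neg R] (A : Matrix (Fin (m + 1)) (Fin (m + 1)) R) : Prop where
  succ_succ : ∀ i j : Fin m, A i.succ j.succ = A i.castSucc j.castSucc
  zero_succ : ∀ j : Fin m, A 0 j.succ = -A (Fin.last m) j.castSucc
  succ_zero : ∀ i : Fin m, A i.succ 0 = -A i.castSucc (Fin.last m)
  zero_zero : A 0 0 = A (Fin.last m) (Fin.last m)

theorem isNegacyclic_negacirculant (m : ℕ) (r : List SignType) :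
    IsNegacyclic (negacirculant m r) where
  succ_succ i j := by
    simp only [negacirculant, Matrix.of_apply, Fin.val_succ, Fin.val_castSucc,
      Nat.add_le_add_iff_right]
    rw [show (j : ℕ) + 1 - (i + 1) = j - i by omega,
      show m + 1 + ((j : ℕ) + 1) - (i + 1) = m + 1 + j - i by omega]
  zero_succ j := by
    have := j.isLt
    simp only [negacirculant, Matrix.of_apply, Fin.val_succ, Fin.val_castSucc, Fin.val_zero,
      Fin.val_last, if_neg (not_le.2 this), neg_neg]
    rw [show m + 1 + (j : ℕ) - m = j + 1 - 0 by omega]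
    exact if_pos (Nat.zero_le _)
  succ_zero i := by
    have := i.isLt
    simp only [negacirculant, Matrix.of_apply, Fin.val_succ, Fin.val_castSucc, Fin.val_zero,
      Fin.val_last, if_pos this.le]
    rw [show m + 1 + 0 - ((i : ℕ) + 1) = m - i by omega]
    exact if_neg (Nat.not_succ_le_zero _)
  zero_zero := by simp [negacirculant]

theorem IsNegacyclic.transpose {R : Type*} [Neg R] {A : Matrix (Fin (m + 1)) (Fin (m + 1)) R}
    (hA : IsNegacyclic A) : IsNegacyclic A.transpose where
  succ_succ i j := hA.succ_succ j i
  zero_succ j := hA.succ_zero j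
  succ_zero i := hA.zero_succ i
  zero_zero := hA.zero_zero

theorem IsNegacyclic.map_cast {a : Matrix (Fin (m + 1)) (Fin (m + 1)) SignType}
    (ha : IsNegacyclic a) : IsNegacyclic (signMatrix a) where
  succ_succ i j := congrArg (fun s : SignType => (s : ZMod 3)) (ha.succ_succ i j)
  zero_succ j := (congrArg _ (ha.zero_succ j)).trans (cast_neg_sign _)
  succ_zero i := (congrArg _ (ha.succ_zero i)).trans (cast_neg_sign _)
  zero_zero := congrArg (fun s : SignType => (s : ZMod 3)) ha.zero_zero

/-- The negacyclic shift of a word. -/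
def negaShift {R : Type*} [Neg R] (u : Fin (m + 1) → R) : Fin (m + 1) → R :=
  Fin.cons (-u (Fin.last m)) fun i => u i.castSucc

theorem negaShift_zero {R : Type*} [Neg R] (u : Fin (m + 1) → R) :
    negaShift u 0 = -u (Fin.last m) := rfl

theorem negaShift_succ {R : Type*} [Neg R] (u : Fin (m + 1) → R) (i : Fin m) :
    negaShift u i.succ = u i.castSucc := rfl

open Matrix in
theorem IsNegacyclic.negaShift_vecMul {R : Type*} [CommRing R]
    {A : Matrix (Fin (m + 1)) (Fin (m + 1)) R} (hA : IsNegacyclic A) (u : Fin (m + 1) → R) :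
    negaShift u ᵥ* A = negaShift (u ᵥ* A) := by
  ext j
  simp only [Matrix.vecMul, dotProduct]
  rw [Fin.sum_univ_succ]
  cases j using Fin.cases with
  | zero =>
    simp only [negaShift_zero, negaShift_succ, Matrix.vecMul, dotProduct, hA.succ_zero,
      hA.zero_zero, Fin.sum_univ_castSucc, mul_neg, neg_mul, Finset.sum_neg_distrib]
    ring
  | succ j =>
    simp only [negaShift_zero, negaShift_succ, Matrix.vecMul, dotProduct, hA.zero_succ,
      hA.succ_succ, Fin.sum_univ_castSucc, mul_neg, neg_mul, neg_neg]
    ring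

theorem hammingNorm_eq_sum {ι : Type*} [Fintype ι] (u : ι → ZMod 3) :
    hammingNorm u = ∑ i, if u i ≠ 0 then 1 else 0 := by
  rw [hammingNorm, Finset.card_filter]

theorem hammingNorm_negaShift (u : Fin (m + 1) → ZMod 3) :
    hammingNorm (negaShift u) = hammingNorm u := by
  simp only [hammingNorm_eq_sum]
  rw [Fin.sum_univ_succ, Fin.sum_univ_castSucc, add_comm]
  have h : ∀ x : ZMod 3, (if -x ≠ 0 then 1 else 0) = if x ≠ 0 then 1 else 0 := by decide
  exact congrArg _ (h _)

theorem hammingNorm_neg {ι : Type*} [Fintype ι] (u : ι → ZMod 3) :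
    hammingNorm (-u) = hammingNorm u := by
  simp [hammingNorm_eq_sum]

/-- A property of words that can be tested up to sign and negacyclic shifts holds for all nonzero
words if it holds for those starting with `1`. -/
theorem of_negaShift {P : (Fin (m + 1) → ZMod 3) → Prop} (hshift : ∀ u, P (negaShift u) → P u)
    (hneg : ∀ u, P (-u) → P u) (h1 : ∀ u, u 0 = 1 → P u) {u : Fin (m + 1) → ZMod 3}
    (hu : u ≠ 0) : P u := by
  have h0 : ∀ u : Fin (m + 1) → ZMod 3, u 0 ≠ 0 → P u := fun u hu => by
    obtain h | h := (by decide : ∀ x : ZMod 3, x ≠ 0 → x = 1 ∨ -x = 1) _ hu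
    · exact h1 u h
    · exact hneg u (h1 _ h)
  have key : ∀ (i : Fin (m + 1)) (u : Fin (m + 1) → ZMod 3), u i ≠ 0 → P u := by
    intro i
    induction i using Fin.reverseInduction with
    | last => exact fun u hu => hshift u (h0 _ (by simpa [negaShift_zero] using hu))
    | cast i ih => exact fun u hu => hshift u (ih _ hu)
  obtain ⟨i, hi⟩ := Function.ne_iff.1 hu
  exact key i u hi

open Matrix in
theorem IsNegacyclic.mul_transpose {A : Matrix (Fin (m + 1)) (Fin (m + 1)) (ZMod 3)}
    (hA : IsNegacyclic A) (h0 : ∀ j, ∑ l, A 0 l * A j l = if j = 0 then -1 else 0) :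
    A * Aᵀ = -1 := by
  have key : ∀ i j, ∑ l, A i l * A j l = if j = i then -1 else 0 := by
    intro i
    induction i using Fin.induction with
    | zero => exact h0
    | succ i ih =>
      intro j
      cases j using Fin.cases with
      | zero =>
        simp only [mul_comm (A i.succ _), h0, Fin.succ_ne_zero, (Fin.succ_ne_zero _).symm,
          if_false]
      | succ j =>
        have h := ih j.castSucc
        rw [Fin.sum_univ_castSucc] at h
        rw [Fin.sum_univ_succ, hA.succ_zero, hA.succ_zero]
        simp only [hA.succ_succ, neg_mul_neg]
        rw [add_comm, h]
        simp
  ext i j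
  rw [Matrix.mul_apply]
  simp only [Matrix.transpose_apply, key, Matrix.neg_apply, Matrix.one_apply, eq_comm (a := j)]
  split_ifs <;> simp

theorem isComb_ofFn : ∀ {m : ℕ} (u : Fin m → ZMod 3) (R : Fin m → List SignType),
    IsComb (List.ofFn R) (hammingNorm u) fun j => ∑ i, u i * signWord (R i) j
  | 0, u, R => by
    simpa [hammingNorm_eq_sum] using (show IsComb [] 0 fun _ => 0 from IsComb.nil)
  | m + 1, u, R => by
    have ih := isComb_ofFn (fun i => u i.succ) fun i => R i.succ
    have hn : hammingNorm u =
        hammingNorm (fun i : Fin m => u i.succ) + if u 0 ≠ 0 then 1 else 0 := by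
      rw [hammingNorm_eq_sum, Fin.sum_univ_succ, add_comm, hammingNorm_eq_sum]
    rw [List.ofFn_succ, hn]
    simp only [Fin.sum_univ_succ]
    change IsComb _ _
      (u 0 • signWord (R 0) + fun j => ∑ i : Fin m, u i.succ * signWord (R i.succ) j)
    obtain h | h | h := (by decide : ∀ x : ZMod 3, x = 0 ∨ x = 1 ∨ x = -1) (u 0)
    · simpa [h] using ih.skip (R 0)
    · simpa [h] using ih.add (R 0)
    · simpa [h] using ih.sub (R 0)

theorem exists_isSignComb_ofFn : ∀ {m : ℕ} (u : Fin m → ZMod 3) (R : Fin m → List SignType),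
    (∀ i, u i ≠ 0) → ∃ e, paritySign e = ∏ i, u i ∧
      IsSignComb (List.ofFn R) e fun j => ∑ i, u i * signWord (R i) j
  | 0, u, R, _ => ⟨false, by
    simpa [paritySign] using (show IsSignComb [] false fun _ => 0 from IsSignComb.nil)⟩
  | m + 1, u, R, hu => by
    obtain ⟨e, he, ih⟩ := exists_isSignComb_ofFn (fun i => u i.succ) (fun i => R i.succ)
      fun i => hu _
    rw [List.ofFn_succ, Fin.prod_univ_succ]
    simp only [Fin.sum_univ_succ]
    change ∃ e, _ ∧ IsSignComb _ e
      (u 0 • signWord (R 0) + fun j => ∑ i : Fin m, u i.succ * signWord (R i.succ) j)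
    obtain h | h := (by decide : ∀ x : ZMod 3, x ≠ 0 → x = 1 ∨ x = -1) (u 0) (hu 0)
    · exact ⟨e, by simp [h, he], by simpa [h] using ih.add (R 0)⟩
    · exact ⟨!e, by simp [h, he, paritySign_not], by simpa [h] using ih.sub (R 0)⟩

theorem signWord_ofFn {n : ℕ} (f : Fin n → SignType) (j : Fin n) :
    signWord (List.ofFn f) j = f j := by
  simp [signWord]

open Matrix in
theorem signWord_add_sum {n : ℕ} (a : Matrix (Fin (m + 1)) (Fin n) SignType)
    {u : Fin (m + 1) → ZMod 3} (hu : u 0 = 1) (j : Fin n) :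
    (signWord (List.ofFn (a 0)) +
      fun j => ∑ i, u (Fin.succ i) * signWord (List.ofFn (a i.succ)) j) j =
      (u ᵥ* signMatrix a) j := by
  simp [Matrix.vecMul, dotProduct, Fin.sum_univ_succ, hu, signWord_ofFn, signMatrix]

open Matrix in
theorem lt_of_checkWeights {n : ℕ} {a : Matrix (Fin (m + 1)) (Fin n) SignType} {d t : ℕ}
    (hd : d ≤ 16) (h : checkWeights (List.ofFn (a 0)) (tailRows a) d t = true)
    {u : Fin (m + 1) → ZMod 3} (hu : u 0 = 1) (ht : hammingNorm u ≤ t) :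
    d < hammingNorm u + hammingNorm (u ᵥ* signMatrix a) := by
  have hu1 : hammingNorm u = hammingNorm (fun i : Fin m => u i.succ) + 1 := by
    simp [hammingNorm_eq_sum, Fin.sum_univ_succ, hu, add_comm]
  have h1 := le_weightBelow_of_checkWeights hd (by simp [tailRows]) h (by omega)
    (isComb_ofFn (fun i : Fin m => u i.succ) fun i => List.ofFn (a i.succ))
  have h2 : weightBelow (List.ofFn (a 0)).length (signWord (List.ofFn (a 0)) +
      fun j => ∑ i, u (Fin.succ i) * signWord (List.ofFn (a i.succ)) j) =
      hammingNorm (u ᵥ* signMatrix a) := by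
    rw [weightBelow, List.length_ofFn, Finset.sum_range, hammingNorm_eq_sum]
    simp only [signWord_add_sum a hu]
  omega

open Matrix in
theorem prod_eq_neg_one_of_checkFullWeight {n : ℕ} {a : Matrix (Fin (m + 1)) (Fin n) SignType}
    (h : checkFullWeight (List.ofFn (a 0)) (tailRows a) = true)
    {u : Fin (m + 1) → ZMod 3} (hu : u 0 = 1) (hu' : ∀ i, u i ≠ 0)
    (hv : ∀ j, (u ᵥ* signMatrix a) j ≠ 0) : (∏ i, u i) * ∏ j, (u ᵥ* signMatrix a) j = -1 := by
  obtain ⟨e, he, hw⟩ := exists_isSignComb_ofFn (fun i : Fin m => u i.succ)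
    (fun i => List.ofFn (a i.succ)) fun i => hu' _
  have h1 := prod_eq_of_checkFullWeight (by simp [tailRows]) h hw fun j hj => by
    rw [List.length_ofFn] at hj
    exact (signWord_add_sum a hu ⟨j, hj⟩).trans_ne (hv _)
  rw [List.length_ofFn, Finset.prod_range, he] at h1
  simp only [signWord_add_sum a hu] at h1
  rw [Fin.prod_univ_succ, hu, one_mul, h1]

open Matrix in
theorem IsNegacyclic.lt_of_checkWeights {a : Matrix (Fin (m + 1)) (Fin (m + 1)) SignType}
    (ha : IsNegacyclic a) {d t : ℕ} (hd : d ≤ 16)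
    (h : checkWeights (List.ofFn (a 0)) (tailRows a) d t = true) {u : Fin (m + 1) → ZMod 3}
    (hu : u ≠ 0) (ht : hammingNorm u ≤ t) :
    d < hammingNorm u + hammingNorm (u ᵥ* signMatrix a) := by
  revert ht
  refine of_negaShift (P := fun u => hammingNorm u ≤ t →
    d < hammingNorm u + hammingNorm (u ᵥ* signMatrix a)) (fun u hu => ?_) (fun u hu => ?_)
    (fun u hu => _root_.lt_of_checkWeights hd h hu) hu
  · rwa [ha.map_cast.negaShift_vecMul, hammingNorm_negaShift, hammingNorm_negaShift] at hu
  · rwa [Matrix.neg_vecMul, hammingNorm_neg, hammingNorm_neg] at hu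

end Negacirculant

section Codes

open Matrix

variable {ι : Type*} {k : ℕ}

/-- The code of the words `(u, uA)`, the coordinates being arranged by `e`. -/
def glueCode (e : ι ≃ Fin k ⊕ Fin k) (A : Matrix (Fin k) (Fin k) (ZMod 3)) :
    Submodule (ZMod 3) (ι → ZMod 3) where
  carrier := {x | (fun j => x (e.symm (.inr j))) = (fun i => x (e.symm (.inl i))) ᵥ* A}
  zero_mem' := (Matrix.zero_vecMul A).symm
  add_mem' hx hy := (congrArg₂ (· + ·) hx hy).trans (Matrix.add_vecMul A _ _).symm
  smul_mem' c _ hx := (congrArg (c • ·) hx).trans (Matrix.smul_vecMul c _ A).symm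

variable {e : ι ≃ Fin k ⊕ Fin k} {A : Matrix (Fin k) (Fin k) (ZMod 3)}

theorem sum_elim_mem_glueCode (u : Fin k → ZMod 3) : Sum.elim u (u ᵥ* A) ∘ e ∈ glueCode e A := by
  change (fun j => _) = (fun i => _) ᵥ* A
  simp

theorem eq_of_mem_glueCode {x : ι → ZMod 3} (hx : x ∈ glueCode e A) :
    ∃ u, x = Sum.elim u (u ᵥ* A) ∘ e := by
  refine ⟨fun i => x (e.symm (.inl i)), ?_⟩
  rw [← e.comp_symm_eq]
  ext (i | j)
  · rfl
  · exact congrFun hx j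

theorem neg_mul_transpose_of {A : Matrix (Fin k) (Fin k) (ZMod 3)} (hA : A * Aᵀ = -1) :
    Aᵀ * A = -1 := by
  have h : A * -Aᵀ = 1 := by rw [Matrix.mul_neg, hA, neg_neg]
  rw [← neg_eq_iff_eq_neg, ← Matrix.neg_mul]
  exact mul_eq_one_comm.1 h

variable [Fintype ι]

theorem isSelfDualCode_glueCode (hA : A * Aᵀ = -1) : IsSelfDualCode (glueCode e A) := by
  have hsum : ∀ u u' v v' : Fin k → ZMod 3, ∑ i, (Sum.elim u v ∘ e) i * (Sum.elim u' v' ∘ e) i =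
      u ⬝ᵥ u' + v ⬝ᵥ v' := fun u u' v v' => by
    rw [← e.symm.sum_comp, Fintype.sum_sum_type]
    simp [dotProduct]
  ext x
  constructor
  · intro hx y hy
    obtain ⟨u, rfl⟩ := eq_of_mem_glueCode hx
    obtain ⟨u', rfl⟩ := eq_of_mem_glueCode hy
    rw [hsum, ← Matrix.dotProduct_mulVec, ← Matrix.mulVec_transpose A u', Matrix.mulVec_mulVec, hA,
      Matrix.neg_mulVec, Matrix.one_mulVec, dotProduct_neg, add_neg_cancel]
  · intro hx
    set u := fun i => x (e.symm (.inl i)) with hu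
    set v := fun j => x (e.symm (.inr j)) with hv
    have hxe : x = Sum.elim u v ∘ e := by
      rw [← e.comp_symm_eq]
      ext (i | j) <;> rfl
    have h : u = -(v ᵥ* Aᵀ) := by
      rw [eq_neg_iff_add_eq_zero]
      refine dotProduct_eq_zero _ fun w => ?_
      have := hx _ (sum_elim_mem_glueCode w)
      rw [hxe, hsum] at this
      rw [add_dotProduct, ← this, ← Matrix.dotProduct_mulVec, Matrix.mulVec_transpose]
    change v = u ᵥ* A
    rw [h, Matrix.neg_vecMul, Matrix.vecMul_vecMul, neg_mul_transpose_of hA, Matrix.vecMul_neg,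
      Matrix.vecMul_one, neg_neg]

theorem hammingNorm_sum_elim (u v : Fin k → ZMod 3) :
    hammingNorm (Sum.elim u v ∘ e) = hammingNorm u + hammingNorm v := by
  rw [hammingNorm_eq_sum, ← e.symm.sum_comp, Fintype.sum_sum_type]
  simp [hammingNorm_eq_sum]

theorem lt_hammingNorm_of_mem_glueCode {m d t : ℕ} {e : ι ≃ Fin (m + 1) ⊕ Fin (m + 1)}
    {a : Matrix (Fin (m + 1)) (Fin (m + 1)) SignType} (ha : IsNegacyclic a)
    (hA : signMatrix a * (signMatrix a)ᵀ = -1) (hd : d ≤ 16) (hdt : d ≤ 2 * t + 2)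
    (h : checkWeights (List.ofFn (a 0)) (tailRows a) d (t + 1) = true)
    (h' : checkWeights (List.ofFn (aᵀ 0)) (tailRows aᵀ) d t = true) {x : ι → ZMod 3}
    (hx : x ∈ glueCode e (signMatrix a)) (hx0 : x ≠ 0) : d < hammingNorm x := by
  obtain ⟨u, rfl⟩ := eq_of_mem_glueCode hx
  have hu0 : u ≠ 0 := by
    rintro rfl
    refine hx0 (funext fun i => ?_)
    rw [Matrix.zero_vecMul]
    cases e i <;> simp
  have hu : (u ᵥ* signMatrix a) ᵥ* signMatrix aᵀ = -u := by
    change (u ᵥ* signMatrix a) ᵥ* (signMatrix a)ᵀ = -u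
    rw [Matrix.vecMul_vecMul, hA, Matrix.vecMul_neg, Matrix.vecMul_one]
  rw [hammingNorm_sum_elim]
  by_cases h1 : hammingNorm u ≤ t + 1
  · exact ha.lt_of_checkWeights hd h hu0 h1
  by_cases h2 : hammingNorm (u ᵥ* signMatrix a) ≤ t
  · have hv0 : u ᵥ* signMatrix a ≠ 0 := by
      intro h0
      rw [h0, Matrix.zero_vecMul, eq_comm, neg_eq_zero] at hu
      exact hu0 hu
    have := ha.transpose.lt_of_checkWeights hd h' hv0 h2
    rwa [hu, hammingNorm_neg, add_comm] at this
  omega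

theorem prod_eq_neg_one_of_mem_glueCode {m : ℕ} {e : ι ≃ Fin (m + 1) ⊕ Fin (m + 1)}
    {a : Matrix (Fin (m + 1)) (Fin (m + 1)) SignType}
    (h : checkFullWeight (List.ofFn (a 0)) (tailRows a) = true) {x : ι → ZMod 3}
    (hx : x ∈ glueCode e (signMatrix a)) (hx0 : ∀ i, x i ≠ 0) : ∏ i, x i = -1 := by
  obtain ⟨u, rfl⟩ := eq_of_mem_glueCode hx
  have hu : ∀ i, u i ≠ 0 := fun i => by simpa using hx0 (e.symm (.inl i))
  have hv : ∀ j, (u ᵥ* signMatrix a) j ≠ 0 := fun j => by simpa using hx0 (e.symm (.inr j))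
  rw [← e.symm.prod_comp, Fintype.prod_sum_type]
  simp only [Function.comp_apply, Equiv.apply_symm_apply, Sum.elim_inl, Sum.elim_inr]
  obtain h0 | h0 := (by decide : ∀ x : ZMod 3, x ≠ 0 → x = 1 ∨ -x = 1) _ (hu 0)
  · exact prod_eq_neg_one_of_checkFullWeight h h0 hu hv
  · have := prod_eq_neg_one_of_checkFullWeight (u := -u) h h0 (fun i => neg_ne_zero.2 (hu i))
      fun j => by
        rw [Matrix.neg_vecMul]
        exact neg_ne_zero.2 (hv j)
    rw [Matrix.neg_vecMul] at this
    simp only [Pi.neg_apply, Finset.prod_neg, Finset.card_univ] at this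
    rwa [mul_mul_mul_comm, ← mul_pow, neg_one_mul, neg_neg, one_pow, one_mul] at this

/-- The product of signs with sum divisible by four. -/
theorem prod_eq_one_of_four_dvd_sum {x : ι → ℤ} (hx : ∀ i, x i = 1 ∨ x i = -1)
    (hn : 4 ∣ Fintype.card ι) (hsum : 4 ∣ ∑ i, x i) : ∏ i, x i = 1 := by
  have key : ∀ s : Finset ι, 2 ∣ ∑ i ∈ s, (x i - 1) ∧
      4 ∣ ∏ i ∈ s, x i - 1 - ∑ i ∈ s, (x i - 1) ∧ (∏ i ∈ s, x i = 1 ∨ ∏ i ∈ s, x i = -1) := by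
    classical
    intro s
    induction s using Finset.induction_on with
    | empty => simp
    | insert i s hi ih =>
      rw [Finset.sum_insert hi, Finset.prod_insert hi]
      obtain ⟨h1, h2, h3⟩ := ih
      obtain h | h := hx i <;> rw [h] <;> omega
  obtain ⟨-, h2, h3⟩ := key Finset.univ
  rw [Finset.sum_sub_distrib] at h2
  simp only [Finset.sum_const, Finset.card_univ, nsmul_eq_mul, mul_one] at h2
  omega

theorem card_le_sum_mul_self {x : ι → ℤ} (hx : ∀ i, Odd (x i)) :
    (Fintype.card ι : ℤ) ≤ ∑ i, x i * x i := by
  have : ∑ _i : ι, (1 : ℤ) ≤ ∑ i, x i * x i := Finset.sum_le_sum fun i _ => by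
    have : x i ≠ 0 := by
      intro h
      have := hx i
      simp [h] at this
    have := mul_self_pos.2 this
    omega
  simpa using this

theorem card_lt_sum_mul_self {C : Submodule (ZMod 3) (ι → ZMod 3)} (hn : 4 ∣ Fintype.card ι)
    (hC : ∀ c ∈ C, (∀ i, c i ≠ 0) → ∏ i, c i = -1) {x : ι → ℤ} (hxC : x ∈ intLattice C)
    (hx : ∀ i, Odd (x i)) : (Fintype.card ι : ℤ) < ∑ i, x i * x i := by
  refine lt_of_le_of_ne (card_le_sum_mul_self hx) fun h => ?_
  have h1 : ∀ i, 1 ≤ x i * x i := fun i => by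
    have := card_le_sum_mul_self (ι := Unit) (x := fun _ => x i) fun _ => hx i
    simpa using this
  have h2 : ∑ i, (x i * x i - 1) = 0 := by
    rw [Finset.sum_sub_distrib, ← h]
    simp
  have h3 : ∀ i, x i = 1 ∨ x i = -1 := fun i => by
    have := (Finset.sum_eq_zero_iff_of_nonneg fun i _ => sub_nonneg.2 (h1 i)).1 h2 i
      (Finset.mem_univ i)
    exact mul_self_eq_one_iff.1 (sub_eq_zero.1 this)
  have h4 := prod_eq_one_of_four_dvd_sum h3 hn hxC.2.2
  have h5 := hC _ hxC.1 fun i => by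
    obtain h | h := h3 i <;> simp [h]
  rw [← Int.cast_prod, h4] at h5
  exact absurd h5 (by decide)

theorem exists_mem_intLattice_of_codeword {C : Submodule (ZMod 3) (ι → ZMod 3)} {c : ι → ZMod 3}
    (hc : c ∈ C) (h2 : 2 ∣ hammingNorm c) :
    ∃ x ∈ intLattice C, ∑ i, x i * x i = 4 * (hammingNorm c : ℤ) := by
  have hlift : ∀ v : ZMod 3, ∃ z : ℤ, (z : ZMod 3) = -v ∧ z * z = if v ≠ 0 then 1 else 0 := by
    intro v
    obtain rfl | rfl | rfl := (by decide : ∀ v : ZMod 3, v = 0 ∨ v = 1 ∨ v = -1) v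
    · exact ⟨0, by simp⟩
    · exact ⟨-1, by simp⟩
    · exact ⟨1, by simp⟩
  choose f hf hf2 using hlift
  have hsum : ∑ i, f (c i) * f (c i) = hammingNorm c := by
    rw [hammingNorm_eq_sum]
    push_cast
    exact Finset.sum_congr rfl fun i _ => hf2 _
  refine ⟨fun i => 2 * f (c i), ⟨?_, ⟨0, fun i => ?_⟩, ?_⟩, ?_⟩
  · convert hc using 1
    ext i
    push_cast
    rw [hf]
    generalize c i = v
    revert v
    decide
  · simp
  · have h : (2 : ℤ) ∣ ∑ i, f (c i) * (f (c i) - 1) := Finset.dvd_sum fun i _ =>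
      even_iff_two_dvd.1 (Int.even_mul_pred_self _)
    simp only [mul_sub, mul_one, Finset.sum_sub_distrib, hsum] at h
    rw [← Finset.mul_sum]
    omega
  · rw [← hsum, Finset.mul_sum]
    exact Finset.sum_congr rfl fun i _ => by ring

theorem exists_mem_intLattice_of_ne (C : Submodule (ZMod 3) (ι → ZMod 3)) {i j : ι} (hij : i ≠ j) :
    ∃ x ∈ intLattice C, ∑ i, x i * x i = 72 := by
  classical
  let y : ι → ℤ := fun l => (if l = i then 1 else 0) + if l = j then 1 else 0
  have hy : ∑ l, y l = 2 := by simp [y, Finset.sum_add_distrib]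
  have hyy : ∀ l, 6 * y l * (6 * y l) = 36 * y l := fun l => by
    obtain rfl | h := eq_or_ne l i
    · simp [y, hij]
    · obtain rfl | h' := eq_or_ne l j <;> simp [y, *]
  refine ⟨fun l => 6 * y l, ⟨?_, ⟨0, fun l => ⟨3 * y l, by ring⟩⟩, ?_⟩, ?_⟩
  · convert C.zero_mem using 1
    ext l
    have : (6 : ZMod 3) = 0 := by decide
    simp [this]
  · rw [← Finset.mul_sum, hy]
    decide
  · simp only [hyy, ← Finset.mul_sum, hy]
    rfl

end Codes

section Existence

open Matrix

theorem exists_lattice_of_negacirculant {m n d t : ℕ} {r : List SignType}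
    (hn : n = (m + 1) + (m + 1)) (hm : 4 ∣ m + 1) (hd : d ≤ 12) (hd6 : 6 ∣ d)
    (hdt : d ≤ 2 * t + 2)
    (horth : ∀ j, ∑ l, signMatrix (negacirculant m r) 0 l * signMatrix (negacirculant m r) j l =
      if j = 0 then -1 else 0)
    (h : checkWeights (List.ofFn (negacirculant m r 0)) (tailRows (negacirculant m r)) d (t + 1) =
      true)
    (h' : checkWeights (List.ofFn ((negacirculant m r)ᵀ 0)) (tailRows (negacirculant m r)ᵀ) d t =
      true)
    (hodd : 4 * d < n ∨ 4 * d = n ∧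
      checkFullWeight (List.ofFn (negacirculant m r 0)) (tailRows (negacirculant m r)) = true)
    (hex : d = 12 ∨ ∃ u : Fin (m + 1) → ZMod 3,
      hammingNorm u + hammingNorm (u ᵥ* signMatrix (negacirculant m r)) = d + 6) :
    ∃ L : Submodule ℤ (Fin n → ℝ), IsLatticeIn L ∧ IsUnimodularLattice L ∧ IsEvenLattice L ∧
      HasMinNorm L (d / 3 + 2) ∧ ∃ f : Fin n → Fin n → ℝ, (∀ i, f i ∈ L) ∧
        ∀ i j, ip (f i) (f j) = if i = j then 12 else 0 := by
  obtain ⟨q, hq⟩ : 4 ∣ n := by omega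
  have hn8 : 8 ∣ Fintype.card (Fin n) := by
    rw [Fintype.card_fin]
    omega
  let e : Fin n ≃ Fin (m + 1) ⊕ Fin (m + 1) := (finCongr hn).trans finSumFinEquiv.symm
  have ha := isNegacyclic_negacirculant m r
  have hA : signMatrix (negacirculant m r) * (signMatrix (negacirculant m r))ᵀ = -1 :=
    ha.map_cast.mul_transpose horth
  have hC := isSelfDualCode_glueCode (e := e) hA
  refine ⟨codeLattice (glueCode e (signMatrix (negacirculant m r))), isLatticeIn_codeLattice _,
    isUnimodularLattice_codeLattice hC hn8, isEvenLattice_codeLattice hC hn8,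
    hasMinNorm_codeLattice hC hn8 hd hd6 (fun c hc hc0 =>
      lt_hammingNorm_of_mem_glueCode ha hA (by omega) hdt h h' hc hc0) (fun x hx hx' => ?_) ?_,
    exists_twelve_frame ((finCongr (hq.trans (mul_comm 4 q))).trans finProdFinEquiv.symm) _⟩
  · have hcard : (Fintype.card (Fin n) : ℤ) = n := by rw [Fintype.card_fin]
    obtain hlt | ⟨heq, hfull⟩ := hodd
    · have := card_le_sum_mul_self hx'
      omega
    · have := card_lt_sum_mul_self (by omega)
        (fun c hc hc0 => prod_eq_neg_one_of_mem_glueCode hfull hc hc0) hx hx'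
      omega
  · obtain rfl | ⟨u, hu⟩ := hex
    · have hij : (⟨0, by omega⟩ : Fin n) ≠ ⟨1, by omega⟩ := by simp
      exact exists_mem_intLattice_of_ne _ hij
    · have hw := hammingNorm_sum_elim (e := e) u (u ᵥ* signMatrix (negacirculant m r))
      obtain ⟨x, hx, hsum⟩ := exists_mem_intLattice_of_codeword
        (sum_elim_mem_glueCode (e := e) (A := signMatrix (negacirculant m r)) u) (by omega)
      refine ⟨x, hx, ?_⟩
      omega

/-- The first row of a negacirculant matrix of order 16. -/
def firstRow16 : List SignType :=
  [1, 1, 0, -1, 1, 0, -1, -1, 0, 1, -1, 0, 0, 0, 0, 0]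

/-- The first row of a negacirculant matrix of order 20. -/
def firstRow20 : List SignType :=
  [0, 0, -1, 0, 0, 0, 1, 1, -1, 0, 1, 0, -1, 1, -1, 1, 0, -1, 0, 1]

/-- The first row of a negacirculant matrix of order 24. -/
def firstRow24 : List SignType :=
  [-1, 1, 0, -1, 1, -1, -1, -1, 1, 0, -1, 0, 0, 0, -1, 1, -1, 0, -1, -1, 0, 1, 1, 1]

/-- The first row of a negacirculant matrix of order 28. -/
def firstRow28 : List SignType :=
  [0, 1, -1, 0, -1, -1, 0, -1, -1, 0, 0, 0, 0, -1, 1, 0, 1, -1, 1, -1, 0, 0, -1, 1, 0, 1, -1, 1]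

/-- The first row of a negacirculant matrix of order 32. -/
def firstRow32 : List SignType :=
  [1, 0, 0, 0, -1, 1, 0, -1, 0, 0, 1, 0, 0, 1, 1, 1, 0, -1, 1, -1, 0, 1, 1, 1, -1, -1, -1, 1, 0, 1,
    -1, 0]

end Existence

/-- 8m-dimensional extremal even unimodular lattices with a 12-frame,
for m = 4,5,6,7,8. -/
theorem exists_extremal_even_unimodular_with_12_frame :
    ∀ m ∈ ({4, 5, 6, 7, 8} : Set ℕ),
      ∃ L : Submodule ℤ (Fin (8 * m) → ℝ), IsLatticeIn L ∧ IsUnimodularLattice L ∧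
        IsEvenLattice L ∧ HasMinNorm L ((2 * ((8 * m) / 24) + 2 : ℕ) : ℝ) ∧
        ∃ f : Fin (8 * m) → (Fin (8 * m) → ℝ), (∀ i, f i ∈ L) ∧
          ∀ i j, ip (f i) (f j) = if i = j then 12 else 0 := by
  rintro m (rfl | rfl | rfl | rfl | rfl)
  · have := exists_lattice_of_negacirculant (m := 15) (n := 32) (d := 6) (t := 2)
      (r := firstRow16) rfl (by norm_num) (by norm_num) (by norm_num) (by norm_num)
      (by decide +kernel) (by decide +kernel) (by decide +kernel) (.inl (by norm_num))
      (.inr ⟨Pi.single 0 1 + Pi.single 1 1, by decide +kernel⟩)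
    norm_num at this ⊢
    exact this
  · have := exists_lattice_of_negacirculant (m := 19) (n := 40) (d := 6) (t := 2)
      (r := firstRow20) rfl (by norm_num) (by norm_num) (by norm_num) (by norm_num)
      (by decide +kernel) (by decide +kernel) (by decide +kernel) (.inl (by norm_num))
      (.inr ⟨Pi.single 0 1, by decide +kernel⟩)
    norm_num at this ⊢
    exact this
  · have := exists_lattice_of_negacirculant (m := 23) (n := 48) (d := 12) (t := 5)
      (r := firstRow24) rfl (by norm_num) (by norm_num) (by norm_num) (by norm_num)
      (by decide +kernel) (by decide +kernel) (by decide +kernel) (.inr ⟨rfl, by decide +kernel⟩)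
      (.inl rfl)
    norm_num at this ⊢
    exact this
  · have := exists_lattice_of_negacirculant (m := 27) (n := 56) (d := 12) (t := 5)
      (r := firstRow28) rfl (by norm_num) (by norm_num) (by norm_num) (by norm_num)
      (by decide +kernel) (by decide +kernel) (by decide +kernel) (.inl (by norm_num))
      (.inl rfl)
    norm_num at this ⊢
    exact this
  · have := exists_lattice_of_negacirculant (m := 31) (n := 64) (d := 12) (t := 5)
      (r := firstRow32) rfl (by norm_num) (by norm_num) (by norm_num) (by norm_num)
      (by decide +kernel) (by decide +kernel) (by decide +kernel) (.inl (by norm_num))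
      (.inl rfl)
    norm_num at this ⊢
    exact this
end

section
/- There exists a self-dual linear code C of length 48 over the field 𝔽₅ (i.e., C = C^⊥ with respect to the standard inner product on 𝔽₅^{48}) such that the Construction A lattice A₅(C) = (1/√5)·{x ∈ ℤ^{48} : (x mod 5) ∈ C} is a unimodular lattice of minimum norm 5. -/
open scoped BigOperators

/-- Five packed tables, indexed by a residue modulo `5`, together with their common length in bits. -/
structure Cell where
  sz : ℕ
  x0 : ℕ
  x1 : ℕ
  x2 : ℕ
  x3 : ℕ
  x4 : ℕ

namespace Cell

def nil : Cell := ⟨0, 0, 0, 0, 0, 0⟩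

def rot1 (q : Cell) : Cell := ⟨q.sz, q.x1, q.x2, q.x3, q.x4, q.x0⟩

/-- Rotation of the residue index by `n`. -/
noncomputable def rot (n : ℕ) (q : Cell) : Cell := Nat.rec q (fun _ r => rot1 r) n

def cat (q r : Cell) : Cell :=
  ⟨q.sz + r.sz, q.x0 + r.x0 <<< q.sz, q.x1 + r.x1 <<< q.sz, q.x2 + r.x2 <<< q.sz,
    q.x3 + r.x3 <<< q.sz, q.x4 + r.x4 <<< q.sz⟩

end Cell

/-- `k n`, where the kernel evaluates `n` to a literal first. -/
noncomputable def strict {β : Type} (n : ℕ) (k : ℕ → β) : β :=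
  Nat.rec (k 0) (fun m _ => k m) (n + 1)

noncomputable def forceCell (q : Cell) (k : Cell → Bool) : Bool :=
  strict q.sz fun s => strict q.x0 fun a => strict q.x1 fun b => strict q.x2 fun c =>
    strict q.x3 fun d => strict q.x4 fun e => k ⟨s, a, b, c, d, e⟩

noncomputable def forceCells : List Cell → (List Cell → Bool) → Bool
  | [], k => k []
  | q :: l, k => forceCell q fun q' => forceCells l fun l' => k (q' :: l')

noncomputable def forceNats : List ℕ → (List ℕ → Bool) → Bool
  | [], k => k []
  | n :: l, k => strict n fun n' => forceNats l fun l' => k (n' :: l')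

noncomputable def slide (α : ℕ) : Cell → Cell → Cell → Cell → List Cell → List Cell
  | _, _, _, _, [] => []
  | a, b, c, d, e :: l =>
    (e.cat ((d.rot α).cat ((d.rot (4 * α % 5)).cat
      ((a.rot (2 * α % 5)).cat (a.rot (3 * α % 5)))))) :: slide α b c d e l

noncomputable def tableK (B : ℕ) : List ℕ → (List Cell → Bool) → Bool
  | [], k => k (List.replicate (B + 1) ⟨9, 0, 1, 4, 4, 1⟩)
  | α :: αs, k => tableK B αs fun T => forceCells (slide α .nil .nil .nil .nil T) k

noncomputable def tablesK (B : ℕ) : List (List ℕ) → (List (List Cell) → Bool) → Bool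
  | [], k => k []
  | αs :: l, k => tableK B αs fun T => tablesK B l fun Ts => k (T :: Ts)

def idCols : ℕ → List (List ℕ)
  | 0 => []
  | m + 1 => (1 :: List.replicate m 0) :: (idCols m).map (0 :: ·)

def nth {α : Type} (d : α) : List α → ℕ → α
  | [], _ => d
  | x :: _, 0 => x
  | _ :: l, n + 1 => nth d l n

noncomputable def sumSel (b : ℕ) : List (List Cell) → List ℕ → ℕ
  | T :: Ts, c :: cs => ((nth .nil T b).rot c).x0 + sumSel b Ts cs
  | _, _ => 0

noncomputable def headsK (Z : List Cell) (I : List (List Cell)) (zs : List ℕ) :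
    List ℕ → (List (ℕ × ℕ) → Bool) → Bool
  | [], k => k []
  | b :: bs, k =>
    strict (sumSel b I zs + (245 - b) * (nth .nil Z b).x1) fun o =>
      strict (256 * (nth .nil Z b).x1) fun M => headsK Z I zs bs fun h => k ((o, M) :: h)

def sqN (v : ℕ) : ℕ := min (v ^ 2) ((5 - v) ^ 2)

noncomputable def dfs (leaf : ℕ → List ℕ → Bool) (lo : ℕ) :
    List (List ℕ × List ℕ × ℕ) → ℕ → List ℕ → Bool
  | [], a, c => !(Nat.ble lo a) || leaf a c
  | p :: pre, a, c => p.2.1.all fun v => !(Nat.ble (a + sqN v) p.2.2) ||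
      forceNats (List.zipWith (fun x r => (x + v * r) % 5) c p.1) fun c' =>
        strict (a + sqN v) fun a' => dfs leaf lo pre a' c'

noncomputable def leafCheck (h : List (ℕ × ℕ)) (Ts : List (List Cell)) (a : ℕ) (c : List ℕ) : Bool :=
  Nat.beq (Nat.land ((nth (0, 0) h (10 - a)).1 + sumSel (10 - a) Ts c) (nth (0, 0) h (10 - a)).2)
    (nth (0, 0) h (10 - a)).2

noncomputable def run (m B : ℕ) (cols : List (List ℕ)) (pre : List (List ℕ × List ℕ × ℕ)) (lo : ℕ) :
    Bool :=
  tableK B (List.replicate m 0) fun Z => tablesK B (idCols m) fun I =>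
    headsK Z I (List.replicate m 0) (List.range (B + 1)) fun h =>
      tablesK B cols fun Ts =>
        dfs (leafCheck h Ts) lo pre 0 (List.replicate cols.length 0)

def negRows : List ℕ := [0,2,4,1,4,1,0,3,2,0,3,0,4,2,0,3,4,2,4,1,4,2,3,2]

def entry (i j : ℕ) : ℕ :=
  if i ≤ j then nth 0 negRows (j - i) else (5 - nth 0 negRows (24 + j - i)) % 5

def order : List ℕ := [0,2,4,6,8,10,12,14,16,18,20,22,1,3,5,7,9,11,13,15,17,19,21,23]

noncomputable def runCode (vals : List (List ℕ × ℕ)) (lo : ℕ) : Bool :=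
  run (24 - vals.length) (10 - lo)
    ((List.range 24).map fun j => (order.drop vals.length).map fun i => entry i j)
    (List.zipWith (fun i v => ((List.range 24).map fun j => entry i j, v)) order vals) lo

theorem strict_eq {β : Type} (n : ℕ) (k : ℕ → β) : strict n k = k n := rfl

theorem forceCell_eq (q : Cell) (k : Cell → Bool) : forceCell q k = k q := rfl

theorem forceCells_eq (l : List Cell) (k : List Cell → Bool) : forceCells l k = k l := by
  induction l generalizing k with
  | nil => rfl
  | cons q l ih => simp only [forceCells, forceCell_eq, ih]

theorem forceNats_eq (l : List ℕ) (k : List ℕ → Bool) : forceNats l k = k l := by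
  induction l generalizing k with
  | nil => rfl
  | cons q l ih => simp only [forceNats, strict_eq, ih]

theorem nth_eq_getD {α : Type} (d : α) (l : List α) (n : ℕ) : nth d l n = l.getD n d := by
  induction l generalizing n with
  | nil => simp [nth]
  | cons x l ih => cases n <;> simp [nth, ih]

theorem nth_map {α β : Type} (d : β) (f : α → β) (d' : α) (l : List α) {n : ℕ} (h : n < l.length) :
    nth d (l.map f) n = f (nth d' l n) := by
  simp [nth_eq_getD, h]

/-- The number whose base `512` digits are the entries of a list. -/
def pack : List ℕ → ℕ
  | [] => 0
  | x :: l => x + 512 * pack l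

theorem pack_append (l r : List ℕ) : pack (l ++ r) = pack l + pack r <<< (9 * l.length) := by
  induction l with
  | nil => simp [pack]
  | cons x l ih =>
    rw [Nat.shiftLeft_eq] at *
    simp only [List.cons_append, pack, ih, List.length_cons]
    ring

section

variable {α : Type*} (l : List α)

theorem pack_map_add (f g : α → ℕ) :
    pack (l.map f) + pack (l.map g) = pack (l.map fun x => f x + g x) := by
  induction l with
  | nil => rfl
  | cons x l ih => simp only [List.map_cons, pack, ← ih]; ring

theorem mul_pack_map (k : ℕ) (f : α → ℕ) : k * pack (l.map f) = pack (l.map fun x => k * f x) := by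
  induction l with
  | nil => rfl
  | cons x l ih => simp only [List.map_cons, pack, ← ih]; ring

theorem pack_map_zero : pack (l.map fun _ => 0) = 0 := by
  induction l with
  | nil => rfl
  | cons x l ih => simp only [List.map_cons, pack, ih]

variable {l}

theorem le_of_pack_land {f : α → ℕ} (hf : ∀ x ∈ l, f x < 512)
    (h : pack (l.map f) &&& pack (l.map fun _ => 256) = pack (l.map fun _ => 256)) :
    ∀ x ∈ l, 256 ≤ f x := by
  induction l with
  | nil => simp
  | cons y l ih =>
    simp only [List.map_cons, pack] at h
    have hy : f y < 512 := hf y (by simp)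
    have h1 := congrArg (· % 2 ^ 9) h
    have h2 := congrArg (· / 2 ^ 9) h
    simp only [Nat.and_mod_two_pow, Nat.and_div_two_pow] at h1 h2
    have e1 : ∀ x m : ℕ, x < 512 → (x + 512 * m) % 2 ^ 9 = x := by omega
    have e2 : ∀ x m : ℕ, x < 512 → (x + 512 * m) / 2 ^ 9 = m := by omega
    rw [e1 _ _ hy, e1 _ _ (by norm_num)] at h1
    rw [e2 _ _ hy, e2 _ _ (by norm_num)] at h2
    intro x hx
    rcases List.mem_cons.1 hx with rfl | hx
    · exact h1 ▸ Nat.and_le_left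
    · exact ih (fun z hz => hf z (List.mem_cons_of_mem _ hz)) h2 x hx

end

/-- The Euclidean weight of a residue modulo `5`. -/
def sqz (x : ZMod 5) : ℕ := sqN x.val

def sqs (l : List (ZMod 5)) : ℕ := (l.map sqz).sum

theorem sqz_le (x : ZMod 5) : sqz x ≤ 4 := by
  revert x; decide

def dot : List ℕ → List (ZMod 5) → ZMod 5
  | a :: l, x :: s => a * x + dot l s
  | _, _ => 0

theorem dot_replicate_zero (m : ℕ) (s : List (ZMod 5)) : dot (List.replicate m 0) s = 0 := by
  induction m generalizing s with
  | zero => simp [dot]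
  | succ m ih => cases s <;> simp [List.replicate_succ, dot, ih]

theorem dot_append {l r : List ℕ} {s t : List (ZMod 5)} (h : l.length = s.length) :
    dot (l ++ r) (s ++ t) = dot l s + dot r t := by
  induction l generalizing s with
  | nil => cases s with
    | nil => simp [dot]
    | cons _ _ => simp at h
  | cons a l ih => cases s with
    | nil => simp at h
    | cons x s => simp only [List.cons_append, dot, ih (by simpa using h)]; ring

/-- The words of length `m` and Euclidean weight at most `n - 4`. -/
def enum : ℕ → ℕ → List (List (ZMod 5))
  | 0, _ + 4 => [[]]
  | m + 1, n + 4 => (enum m (n + 4)).map (0 :: ·) ++ ((enum m (n + 3)).map (1 :: ·) ++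
      ((enum m (n + 3)).map (4 :: ·) ++ ((enum m n).map (2 :: ·) ++ (enum m n).map (3 :: ·))))
  | _, _ => []

theorem mem_enum {s : List (ZMod 5)} {n : ℕ} (h : sqs s ≤ n) : s ∈ enum s.length (n + 4) := by
  induction s generalizing n with
  | nil => simp [enum]
  | cons x s ih =>
    simp only [sqs, List.map_cons, List.sum_cons] at h
    have hs : ∀ k, sqz x + k = n → s ∈ enum s.length (k + 4) := fun k hk => ih (by
      simp only [sqs]; omega)
    have hx : ∀ x : ZMod 5, x = 0 ∨ x = 1 ∨ x = 4 ∨ x = 2 ∨ x = 3 := by decide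
    have v1 : sqz 1 = 1 := rfl
    have v2 : sqz 2 = 4 := rfl
    have v3 : sqz 3 = 4 := rfl
    have v4 : sqz 4 = 1 := rfl
    simp only [List.length_cons, enum, List.mem_append, List.mem_map, List.cons.injEq]
    rcases hx x with rfl | rfl | rfl | rfl | rfl
    · exact .inl ⟨s, ih (by simp only [sqs]; omega), rfl, rfl⟩
    · obtain ⟨k, rfl⟩ : ∃ k, n = k + 1 := ⟨n - 1, by omega⟩
      exact .inr (.inl ⟨s, hs k (by omega), rfl, rfl⟩)
    · obtain ⟨k, rfl⟩ : ∃ k, n = k + 1 := ⟨n - 1, by omega⟩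
      exact .inr (.inr (.inl ⟨s, hs k (by omega), rfl, rfl⟩))
    · obtain ⟨k, rfl⟩ : ∃ k, n = k + 4 := ⟨n - 4, by omega⟩
      exact .inr (.inr (.inr (.inl ⟨s, hs k (by omega), rfl, rfl⟩)))
    · obtain ⟨k, rfl⟩ : ∃ k, n = k + 4 := ⟨n - 4, by omega⟩
      exact .inr (.inr (.inr (.inr ⟨s, hs k (by omega), rfl, rfl⟩)))

namespace Cell

def tabulate (s : ℕ) (f : ZMod 5 → ℕ) : Cell := ⟨s, f 0, f 1, f 2, f 3, f 4⟩

theorem rot_tabulate (n s : ℕ) (f : ZMod 5 → ℕ) :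
    rot n (tabulate s f) = tabulate s fun c => f (c + n) := by
  induction n with
  | zero => simp [rot]
  | succ n ih =>
    have h : rot (n + 1) (tabulate s f) = rot1 (rot n (tabulate s f)) := rfl
    have e : ∀ c : ZMod 5, c + ((n + 1 : ℕ) : ZMod 5) = (c + 1) + n := fun c => by push_cast; ring
    rw [h, ih]
    simp only [tabulate, rot1, e]
    rfl

theorem cat_tabulate (s t : ℕ) (f g : ZMod 5 → ℕ) :
    cat (tabulate s f) (tabulate t g) = tabulate (s + t) fun c => f c + g c <<< s := rfl

end Cell

/-- The packed values of `x ↦ sqz (c + l ⬝ x)` over the words `x` of bounded Euclidean weight. -/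
def tab (l : List ℕ) (n : ℕ) : Cell :=
  .tabulate (9 * (enum l.length n).length) fun c =>
    pack ((enum l.length n).map fun s => sqz (c + dot l s))

theorem tab_cons (a : ℕ) (l : List ℕ) (n : ℕ) :
    tab (a :: l) (n + 4) = (tab l (n + 4)).cat (((tab l (n + 3)).rot a).cat
      (((tab l (n + 3)).rot (4 * a % 5)).cat (((tab l n).rot (2 * a % 5)).cat
        ((tab l n).rot (3 * a % 5))))) := by
  simp only [tab, Cell.rot_tabulate, Cell.cat_tabulate, List.length_cons, enum, List.map_append,
    pack_append, List.length_append, List.length_map, List.map_map, Function.comp_def, dot,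
    ZMod.natCast_mod, Nat.cast_mul, Nat.cast_ofNat, Nat.mul_add, add_assoc, mul_comm (a : ZMod 5),
    zero_mul, one_mul, zero_add]

theorem slide_eq (a : ℕ) (l : List ℕ) (n k : ℕ) :
    slide a (tab l n) (tab l (n + 1)) (tab l (n + 2)) (tab l (n + 3))
      ((List.range' (n + 4) k).map (tab l)) = (List.range' (n + 4) k).map (tab (a :: l)) := by
  induction k generalizing n with
  | zero => rfl
  | succ k ih =>
    simp only [List.range'_succ, List.map_cons, slide, tab_cons, List.cons.injEq, true_and]
    exact ih (n + 1)

theorem tab_of_lt_four (l : List ℕ) {n : ℕ} (h : n < 4) : tab l n = .nil := by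
  have : enum l.length n = [] := by
    interval_cases n <;> cases l <;> simp [enum]
  simp only [tab, this]
  rfl

def tableOf (B : ℕ) (l : List ℕ) : List Cell := (List.range' 4 (B + 1)).map (tab l)

theorem tableK_eq (B : ℕ) (l : List ℕ) (k : List Cell → Bool) :
    tableK B l k = k (tableOf B l) := by
  induction l generalizing k with
  | nil =>
    simp only [tableK, tableOf]
    congr 1
    refine (List.eq_replicate_iff.2 ⟨by simp, fun q hq => ?_⟩).symm
    obtain ⟨n, hn, rfl⟩ := List.mem_map.1 hq
    obtain ⟨j, rfl⟩ : ∃ j, n = j + 4 := ⟨n - 4, by simp at hn; omega⟩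
    rfl
  | cons a l ih =>
    have := slide_eq a l 0 (B + 1)
    simp only [zero_add, tab_of_lt_four l (show 0 < 4 by omega),
      tab_of_lt_four l (show 1 < 4 by omega), tab_of_lt_four l (show 2 < 4 by omega),
      tab_of_lt_four l (show 3 < 4 by omega)] at this
    simp only [tableK, ih, forceCells_eq, tableOf, this]

theorem tablesK_eq (B : ℕ) (l : List (List ℕ)) (k : List (List Cell) → Bool) :
    tablesK B l k = k (l.map (tableOf B)) := by
  induction l generalizing k with
  | nil => rfl
  | cons a l ih => simp only [tablesK, tableK_eq, ih, List.map_cons]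

theorem nth_tableOf {B b : ℕ} (h : b ≤ B) (l : List ℕ) :
    nth .nil (tableOf B l) b = tab l (b + 4) := by
  rw [tableOf, nth_map _ _ 0 _ (by simpa using Nat.lt_succ_of_le h), nth_eq_getD]
  congr 1
  rw [List.getD_eq_getElem _ _ (by simpa using Nat.lt_succ_of_le h)]
  simp [add_comm]

/-- The Euclidean weight of the word with coordinates `c + l ⬝ s`. -/
def wsum : List (List ℕ) → List ℕ → List (ZMod 5) → ℕ
  | l :: cols, c :: cs, s => sqz (c + dot l s) + wsum cols cs s
  | _, _, _ => 0

theorem wsum_le (cols : List (List ℕ)) (cs : List ℕ) (s : List (ZMod 5)) :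
    wsum cols cs s ≤ 4 * cols.length := by
  induction cols generalizing cs with
  | nil => simp [wsum]
  | cons l cols ih => cases cs with
    | nil => simp [wsum]
    | cons c cs =>
      simp only [wsum, List.length_cons]
      have := ih cs
      have := sqz_le (c + dot l s)
      omega

theorem sumSel_eq {B b m : ℕ} (h : b ≤ B) {cols : List (List ℕ)} (hc : ∀ l ∈ cols, l.length = m)
    (cs : List ℕ) :
    sumSel b (cols.map (tableOf B)) cs = pack ((enum m (b + 4)).map (wsum cols cs)) := by
  induction cols generalizing cs with
  | nil => exact (pack_map_zero _).symm
  | cons l cols ih => cases cs with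
    | nil => exact (pack_map_zero _).symm
    | cons c cs =>
      have hl : l.length = m := hc l (by simp)
      simp only [List.map_cons, sumSel, nth_tableOf h, tab, Cell.rot_tabulate,
        ih (fun l hl => hc l (List.mem_cons_of_mem _ hl)) cs, hl]
      simp only [Cell.tabulate, zero_add, pack_map_add]
      rfl

theorem wsum_map_cons_zero (cols : List (List ℕ)) (cs : List ℕ) (x : ZMod 5) (s : List (ZMod 5)) :
    wsum (cols.map (0 :: ·)) cs (x :: s) = wsum cols cs s := by
  induction cols generalizing cs with
  | nil => simp [wsum]
  | cons l cols ih => cases cs <;> simp [wsum, dot, ih]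

theorem wsum_idCols (s : List (ZMod 5)) :
    wsum (idCols s.length) (List.replicate s.length 0) s = sqs s := by
  induction s with
  | nil => rfl
  | cons x s ih =>
    simp [idCols, List.replicate_succ, wsum, dot, dot_replicate_zero, wsum_map_cons_zero, ih, sqs]

theorem length_idCols (m : ℕ) : (idCols m).length = m := by
  induction m with
  | zero => rfl
  | succ m ih => simp [idCols, ih]

theorem length_of_mem_idCols {m : ℕ} {l : List ℕ} (h : l ∈ idCols m) : l.length = m := by
  induction m generalizing l with
  | zero => simp [idCols] at h
  | succ m ih =>
    simp only [idCols, List.mem_cons, List.mem_map] at h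
    rcases h with rfl | ⟨r, hr, rfl⟩
    · simp
    · simp [ih hr]

theorem headsK_eq (Z : List Cell) (I : List (List Cell)) (zs bs : List ℕ)
    (k : List (ℕ × ℕ) → Bool) :
    headsK Z I zs bs k = k (bs.map fun b =>
      (sumSel b I zs + (245 - b) * (nth .nil Z b).x1, 256 * (nth .nil Z b).x1)) := by
  induction bs generalizing k with
  | nil => rfl
  | cons b bs ih => simp only [headsK, strict_eq, ih, List.map_cons]

/-- The offsets and the masks used by `leafCheck`. -/
noncomputable def headsOf (m B : ℕ) : List (ℕ × ℕ) :=
  (List.range (B + 1)).map fun b =>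
    (sumSel b ((idCols m).map (tableOf B)) (List.replicate m 0) +
      (245 - b) * (nth .nil (tableOf B (List.replicate m 0)) b).x1,
      256 * (nth .nil (tableOf B (List.replicate m 0)) b).x1)

theorem leafCheck_spec {B a : ℕ} {cols : List (List ℕ)} {c : List ℕ} {s : List (ZMod 5)}
    (hc : ∀ l ∈ cols, l.length = s.length) (hcols : cols.length = 24) (hs : s.length ≤ 24)
    (ha : a + sqs s ≤ 10) (hB : 10 - a ≤ B)
    (h : leafCheck (headsOf s.length B) (cols.map (tableOf B)) a c = true) :
    21 ≤ a + sqs s + wsum cols c s := by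
  have hx : ∀ b, (tab (List.replicate s.length 0) b).x1 =
      pack ((enum s.length b).map fun _ => 1) := fun b => by
    simp only [tab, Cell.tabulate, dot_replicate_zero, List.length_replicate]
    rfl
  have hr : 10 - a < (List.range (B + 1)).length := by simpa using Nat.lt_succ_of_le hB
  have hn : nth 0 (List.range (B + 1)) (10 - a) = 10 - a := by
    rw [nth_eq_getD, List.getD_eq_getElem _ _ hr, List.getElem_range]
  have h := Nat.eq_of_beq_eq_true h
  simp only [headsOf, nth_map _ _ 0 _ hr, hn, nth_tableOf hB, hx,
    sumSel_eq hB (fun l => length_of_mem_idCols), sumSel_eq hB hc, mul_pack_map, pack_map_add] at h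
  have key := le_of_pack_land (fun x _ => ?_) h s (mem_enum (by omega))
  · rw [wsum_idCols] at key
    omega
  · have h1 := wsum_le (idCols s.length) (List.replicate s.length 0) x
    have h2 := wsum_le cols c x
    rw [length_idCols] at h1
    omega

/-- The state reached by `dfs` after processing the word `w`. -/
def accum : List ℕ → List (List ℕ × List ℕ × ℕ) → List (ZMod 5) → List ℕ
  | c, p :: pre, x :: w => accum (List.zipWith (fun y r => (y + x.val * r) % 5) c p.1) pre w
  | c, _, _ => c

/-- The words visited by `dfs`. -/
def Admissible : List (List ℕ × ℕ) → ℕ → List (ZMod 5) → Prop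
  | [], _, [] => True
  | p :: pre, a, x :: w => x.val ∈ p.1 ∧ a + sqz x ≤ p.2 ∧ Admissible pre (a + sqz x) w
  | _, _, _ => False

theorem dfs_spec {leaf : ℕ → List ℕ → Bool} {lo a : ℕ} {pre : List (List ℕ × List ℕ × ℕ)}
    {c : List ℕ} (h : dfs leaf lo pre a c = true) {w : List (ZMod 5)}
    (hw : Admissible (pre.map Prod.snd) a w) (hlo : lo ≤ a + sqs w) :
    leaf (a + sqs w) (accum c pre w) = true := by
  induction pre generalizing a c w with
  | nil => cases w with
    | nil =>
      simp only [sqs, List.map_nil, List.sum_nil, add_zero] at hlo ⊢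
      simpa [dfs, accum, Nat.ble_eq_true_of_le hlo] using h
    | cons x w => exact hw.elim
  | cons p pre ih => cases w with
    | nil => exact hw.elim
    | cons x w =>
      obtain ⟨h1, h2, h3⟩ := hw
      simp only [dfs, List.all_eq_true, forceNats_eq, strict_eq] at h
      have := h _ h1
      rw [show sqN x.val = sqz x from rfl, Nat.ble_eq_true_of_le h2] at this
      simp only [Bool.not_true, Bool.false_or] at this
      have e : sqs (x :: w) = sqz x + sqs w := rfl
      rw [e, ← add_assoc] at hlo ⊢
      exact ih this h3 hlo

theorem accum_eq {w : List (ZMod 5)} (js : List ℕ) (row : ℕ → ℕ → ℕ) {is : List ℕ}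
    {vals : List (List ℕ × ℕ)} (hi : vals.length = w.length) (hv : w.length ≤ is.length)
    (f : ℕ → ℕ) :
    ∃ g : ℕ → ℕ, accum (js.map f) (List.zipWith (fun i v => (js.map (row i), v)) is vals) w =
      js.map g ∧ ∀ j, (g j : ZMod 5) = f j + dot ((is.take w.length).map (row · j)) w := by
  induction w generalizing is vals f with
  | nil =>
    obtain rfl := List.length_eq_zero_iff.1 hi
    exact ⟨f, by cases is <;> simp [accum], by simp [dot]⟩
  | cons x w ih =>
    obtain ⟨v, vals, rfl⟩ := List.exists_cons_of_length_eq_add_one hi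
    cases is with
    | nil => simp at hv
    | cons i is =>
      obtain ⟨g, h1, h2⟩ := ih (is := is) (vals := vals) (by simpa using hi) (by simpa using hv)
        fun j => (f j + x.val * row i j) % 5
      refine ⟨g, ?_, fun j => ?_⟩
      · simpa [accum, List.zipWith_map, List.zipWith_self] using h1
      · rw [h2]
        simp only [List.length_cons, List.take_succ_cons, List.map_cons, dot, ZMod.natCast_mod,
          Nat.cast_add, Nat.cast_mul, ZMod.natCast_zmod_val]
        ring

theorem wsum_map (js : List ℕ) (C : ℕ → List ℕ) (g : ℕ → ℕ) (s : List (ZMod 5)) :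
    wsum (js.map C) (js.map g) s = (js.map fun j => sqz (g j + dot (C j) s)).sum := by
  induction js with
  | nil => rfl
  | cons j js ih => simp [wsum, ih]

theorem runCode_spec {vals : List (List ℕ × ℕ)} {lo : ℕ} (h : runCode vals lo = true)
    {w s : List (ZMod 5)} (hlen : (w ++ s).length = 24) (hw : Admissible vals 0 w)
    (hv : vals.length = w.length) (hlo : lo ≤ sqs w) (hhi : sqs (w ++ s) ≤ 10) :
    21 ≤ sqs (w ++ s) +
      ((List.range 24).map fun j => sqz (dot (order.map (entry · j)) (w ++ s))).sum := by
  have hlen' : w.length + s.length = 24 := by simpa using hlen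
  have hm : 24 - vals.length = s.length := by omega
  have ho : order.length = 24 := rfl
  have e : sqs (w ++ s) = sqs w + sqs s := by simp [sqs]
  rw [runCode, run, tableK_eq, tablesK_eq, headsK_eq, tablesK_eq, hm, hv] at h
  have hpre : (List.zipWith (fun i v => ((List.range 24).map fun j => entry i j, v)) order
      vals).map Prod.snd = vals := by
    have := List.map_snd_zip (l₁ := order) (l₂ := vals) (by omega)
    rw [List.zip, List.map_zipWith] at this
    rwa [List.map_zipWith]
  have h := dfs_spec h (w := w) (by rwa [hpre]) (by simpa using hlo)
  obtain ⟨g, h1, h2⟩ := accum_eq (List.range 24) entry (is := order) hv (by omega) fun _ => 0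
  have hz : List.replicate (((List.range 24).map fun j =>
      (order.drop w.length).map fun i => entry i j).length) 0 =
      (List.range 24).map fun _ => 0 := by simp
  rw [hz, h1, zero_add] at h
  have key := leafCheck_spec (s := s) (B := 10 - lo) ?_ (by simp) (by omega) (by omega) (by omega) h
  · rw [wsum_map] at key
    rw [e]
    convert key using 5 with j
    simp only [h2, Nat.cast_zero, zero_add]
    rw [← dot_append (by simp; omega), ← List.map_append, List.take_append_drop]
  · intro l hl
    obtain ⟨j, -, rfl⟩ := List.mem_map.1 hl
    simp
    omega

def anyVal : List ℕ := [0, 1, 2, 3, 4]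

/-- Allow the values in `l`, with total Euclidean weight at most `a`. -/
def cap (a : ℕ) (l : List (List ℕ)) : List (List ℕ × ℕ) := l.map fun v => (v, a)

/-- Allowed values on the even coordinates, the first three being restricted, and the last two zero. -/
def evenVals (u v w : List ℕ) : List (List ℕ) :=
  u :: v :: w :: (List.replicate 7 anyVal ++ [[0], [0]])

set_option maxRecDepth 10000

theorem run_five_zero_zero : runCode (cap 5 (evenVals [1, 2] [0] [0])) 5 = true := by
  decide +kernel

theorem run_five_zero_pos : runCode (cap 5 (evenVals [1, 2] [0] [1, 2])) 5 = true := by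
  decide +kernel

theorem run_five_zero_neg : runCode (cap 5 (evenVals [1, 2] [0] [3, 4])) 5 = true := by
  decide +kernel

theorem run_five_pos : runCode (cap 5 (evenVals [1, 2] [1, 2] anyVal)) 5 = true := by
  decide +kernel

theorem run_five_neg : runCode (cap 5 (evenVals [1, 2] [3, 4] anyVal)) 5 = true := by
  decide +kernel

theorem run_four_zero : runCode (cap 4 (evenVals [1, 2] [0] anyVal)) 4 = true := by
  decide +kernel

theorem run_four_pos : runCode (cap 4 (evenVals [1, 2] [1, 2] anyVal)) 4 = true := by
  decide +kernel

theorem run_four_neg : runCode (cap 4 (evenVals [1, 2] [3, 4] anyVal)) 4 = true := by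
  decide +kernel

theorem run_three : runCode (cap 3 (evenVals [1, 2] anyVal anyVal)) 3 = true := by
  decide +kernel

theorem run_two :
    runCode (cap 2 (evenVals [1] anyVal anyVal) ++ cap 10 [anyVal, anyVal]) 1 = true := by
  decide +kernel

theorem run_zero :
    runCode (cap 10 (List.replicate 12 [0] ++ [[1, 2], anyVal])) 1 = true := by
  decide +kernel

theorem mem_anyVal (x : ZMod 5) : x.val ∈ anyVal := by
  revert x; decide

theorem admissible_cap {l : List (List ℕ)} {w : List (ZMod 5)} {a b : ℕ}
    (h : List.Forall₂ (fun v x => x.val ∈ v) l w) (hs : a + sqs w ≤ b) :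
    Admissible (cap b l) a w := by
  induction h generalizing a with
  | nil => trivial
  | cons h _ ih =>
    simp only [sqs, List.map_cons, List.sum_cons] at hs
    exact ⟨h, by dsimp only; omega, ih (by simp only [sqs]; omega)⟩

theorem Admissible.append {l r : List (List ℕ × ℕ)} {v w : List (ZMod 5)} {a : ℕ}
    (h : Admissible l a v) (h' : Admissible r (a + sqs v) w) : Admissible (l ++ r) a (v ++ w) := by
  induction l generalizing a v with
  | nil => cases v with
    | nil => simpa [sqs] using h'
    | cons x v => exact h.elim
  | cons p l ih => cases v with
    | nil => exact h.elim
    | cons x v =>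
      refine ⟨h.1, h.2.1, ih h.2.2 ?_⟩
      simpa [sqs, add_assoc] using h'

/-- The coordinates, even ones first. -/
def finOrder : List (Fin 24) :=
  [0, 2, 4, 6, 8, 10, 12, 14, 16, 18, 20, 22, 1, 3, 5, 7, 9, 11, 13, 15, 17, 19, 21, 23]

def negMat : Matrix (Fin 24) (Fin 24) (ZMod 5) := fun i j => (entry i j : ZMod 5)

/-- The Euclidean weight of `u`. -/
def weight {n : ℕ} (u : Fin n → ZMod 5) : ℕ := ∑ i, sqz (u i)

def evens (u : Fin 24 → ZMod 5) : List (ZMod 5) :=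
  [u 0, u 2, u 4, u 6, u 8, u 10, u 12, u 14, u 16, u 18, u 20, u 22]

def odds (u : Fin 24 → ZMod 5) : List (ZMod 5) :=
  [u 1, u 3, u 5, u 7, u 9, u 11, u 13, u 15, u 17, u 19, u 21, u 23]

theorem sum_finOrder {M : Type*} [AddCommMonoid M] (f : Fin 24 → M) :
    (finOrder.map f).sum = ∑ i, f i := by
  have h : finOrder.Perm (List.finRange 24) := by decide
  rw [Fin.sum_univ_def, (h.map f).sum_eq]

theorem sqs_evens_add_odds (u : Fin 24 → ZMod 5) : sqs (evens u) + sqs (odds u) = weight u := by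
  rw [weight, ← sum_finOrder fun i => sqz (u i)]
  simp [finOrder, sqs, evens, odds, add_assoc]

theorem dot_map {ι : Type*} (l : List ι) (f : ι → ℕ) (g : ι → ZMod 5) :
    dot (l.map f) (l.map g) = (l.map fun i => g i * f i).sum := by
  induction l with
  | nil => rfl
  | cons i l ih => simp [dot, ih, mul_comm]

theorem heavy_of_run {vals : List (List ℕ × ℕ)} {lo : ℕ} (h : runCode vals lo = true)
    {u : Fin 24 → ZMod 5} {w s : List (ZMod 5)} (hws : w ++ s = evens u ++ odds u)
    (hw : Admissible vals 0 w) (hv : vals.length = w.length) (hlo : lo ≤ sqs w)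
    (hu : weight u ≤ 10) : 21 ≤ weight u + weight (Matrix.vecMul u negMat) := by
  have hl : evens u ++ odds u = finOrder.map u := rfl
  have hs : sqs (finOrder.map u) = weight u := by
    rw [sqs, List.map_map, sum_finOrder]; rfl
  have key := runCode_spec h (w := w) (s := s) (by rw [hws]; rfl) hw hv hlo
    (by rwa [hws, hl, hs])
  rw [hws, hl, hs] at key
  convert key using 2
  have ho : order = finOrder.map Fin.val := rfl
  rw [weight, ← List.map_coe_finRange_eq_range, List.map_map, Fin.sum_univ_def]
  refine congrArg List.sum (List.map_congr_left fun j _ => ?_)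
  simp only [Function.comp_apply, ho, List.map_map]
  rw [dot_map, sum_finOrder]
  rfl

theorem mem_or_neg_mem {x : ZMod 5} (h : x ≠ 0) :
    x.val ∈ [1, 2] ∨ (-x).val ∈ [1, 2] := by
  revert x; decide

theorem sqz_neg (x : ZMod 5) : sqz (-x) = sqz x := by
  revert x; decide

theorem sqz_eq_zero {x : ZMod 5} : sqz x = 0 ↔ x = 0 := by
  revert x; decide

theorem weight_neg {n : ℕ} (u : Fin n → ZMod 5) : weight (-u) = weight u := by
  simp [weight, sqz_neg]

theorem evens_neg (u : Fin 24 → ZMod 5) : sqs (evens (-u)) = sqs (evens u) := by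
  simp [sqs, evens, sqz_neg]

/-- The codeword `(u, u ⬝ negMat)` is zero or has Euclidean weight at least `21`. -/
def Heavy (u : Fin 24 → ZMod 5) : Prop := 21 ≤ weight u + weight (Matrix.vecMul u negMat)

theorem heavy_neg {u : Fin 24 → ZMod 5} : Heavy (-u) ↔ Heavy u := by
  simp [Heavy, Matrix.neg_vecMul, weight_neg]

theorem forall₂_evens {u : Fin 24 → ZMod 5} {t v w : List ℕ} (ht : (u 0).val ∈ t)
    (hv : (u 2).val ∈ v) (hw : (u 4).val ∈ w) (h20 : u 20 = 0) (h22 : u 22 = 0) :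
    List.Forall₂ (fun v x => x.val ∈ v) (evenVals t v w) (evens u) := by
  simp [evenVals, evens, List.replicate, mem_anyVal, ht, hv, hw, h20, h22]

theorem heavy_of_evens {u : Fin 24 → ZMod 5} (hu : weight u ≤ 10) (he : sqs (evens u) ≤ 5)
    (h0 : u 0 ≠ 0) (h20 : u 20 = 0) (h22 : u 22 = 0) : Heavy u := by
  wlog h : (u 0).val ∈ [1, 2] generalizing u
  · rw [← heavy_neg]
    exact this ((weight_neg u).trans_le hu) ((evens_neg u).trans_le he) (by simpa using h0)
      (by simpa using h20) (by simpa using h22) ((mem_or_neg_mem h0).resolve_left h)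
  have run : ∀ a v w, runCode (cap a (evenVals [1, 2] v w)) a = true → (u 2).val ∈ v →
      (u 4).val ∈ w → sqs (evens u) = a → Heavy u := fun a v w hr hv hw ha =>
    heavy_of_run hr rfl (admissible_cap (forall₂_evens h hv hw h20 h22) (by omega)) rfl ha.ge hu
  have cases : ∀ x : ZMod 5, x.val ∈ [0] ∨ x.val ∈ [1, 2] ∨ x.val ∈ [3, 4] := by decide
  rcases (show sqs (evens u) ≤ 2 ∨ sqs (evens u) = 3 ∨ sqs (evens u) = 4 ∨ sqs (evens u) = 5 by
    omega) with h2 | h3 | h4 | h5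
  · have e : sqs (evens u) = sqz (u 0) + sqs (evens u).tail := rfl
    have h1 : (u 0).val ∈ [1] ∧ 1 ≤ sqz (u 0) := by
      have : sqz (u 0) ≤ 2 := by omega
      revert h this
      generalize u 0 = x
      revert x
      decide
    refine heavy_of_run run_two (w := evens u ++ [u 1, u 3]) rfl
      ((admissible_cap (forall₂_evens h1.1 (mem_anyVal _) (mem_anyVal _) h20 h22)
        (by omega)).append (admissible_cap (by simp [mem_anyVal]) ?_)) rfl ?_ hu
    · rw [← sqs_evens_add_odds] at hu
      have : sqs (odds u) = sqs [u 1, u 3] + sqs (odds u).tail.tail := by simp [sqs, odds, add_assoc]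
      omega
    · have : sqs (evens u ++ [u 1, u 3]) = sqs (evens u) + sqs [u 1, u 3] := by simp [sqs]
      omega
  · exact run _ _ _ run_three (mem_anyVal _) (mem_anyVal _) h3
  · rcases cases (u 2) with h2 | h2 | h2
    · exact run _ _ _ run_four_zero h2 (mem_anyVal _) h4
    · exact run _ _ _ run_four_pos h2 (mem_anyVal _) h4
    · exact run _ _ _ run_four_neg h2 (mem_anyVal _) h4
  · rcases cases (u 2) with h2 | h2 | h2
    · rcases cases (u 4) with h2' | h2' | h2'
      · exact run _ _ _ run_five_zero_zero h2 h2' h5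
      · exact run _ _ _ run_five_zero_pos h2 h2' h5
      · exact run _ _ _ run_five_zero_neg h2 h2' h5
    · exact run _ _ _ run_five_pos h2 (mem_anyVal _) h5
    · exact run _ _ _ run_five_neg h2 (mem_anyVal _) h5

theorem heavy_of_evens_eq_zero {u : Fin 24 → ZMod 5} (hu : weight u ≤ 10) (he : sqs (evens u) = 0)
    (h1 : u 1 ≠ 0) : Heavy u := by
  wlog h : (u 1).val ∈ [1, 2] generalizing u
  · rw [← heavy_neg]
    exact this ((weight_neg u).trans_le hu) ((evens_neg u).trans he) (by simpa using h1)
      ((mem_or_neg_mem h1).resolve_left h)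
  have hodd := sqs_evens_add_odds u
  have e : sqs (odds u) = sqs [u 1, u 3] + sqs (odds u).tail.tail := by simp [sqs, odds, add_assoc]
  have e' : sqs (evens u ++ [u 1, u 3]) = sqs (evens u) + sqs [u 1, u 3] := by simp [sqs]
  have e'' : sqs [u 1, u 3] = sqz (u 1) + sqz (u 3) := by simp [sqs]
  have h1' := mt sqz_eq_zero.1 h1
  refine heavy_of_run run_zero (w := evens u ++ [u 1, u 3]) rfl (admissible_cap ?_ ?_) rfl ?_ hu
  · simp only [sqs, evens, List.map_cons, List.sum_cons, Nat.add_eq_zero_iff, sqz_eq_zero] at he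
    simp [List.replicate, evens, mem_anyVal, he, h]
  · omega
  · omega

/-- The negacyclic shift. -/
def shift (u : Fin 24 → ZMod 5) : Fin 24 → ZMod 5 := fun i => if i = 0 then -u (i - 1) else u (i - 1)

theorem shift_apply (u : Fin 24 → ZMod 5) (i : Fin 24) :
    shift u i = u (i - 1) ∨ shift u i = -u (i - 1) := by
  unfold shift
  split <;> simp

section

open scoped Fin.CommRing

theorem iterate_shift_apply (u : Fin 24 → ZMod 5) (n : ℕ) (i : Fin 24) :
    shift^[n] u i = u (i - (n : Fin 24)) ∨ shift^[n] u i = -u (i - (n : Fin 24)) := by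
  induction n generalizing i with
  | zero => simp
  | succ n ih =>
    rw [Function.iterate_succ_apply']
    have e : i - ((n + 1 : ℕ) : Fin 24) = i - 1 - (n : Fin 24) := by push_cast; abel
    rw [e]
    rcases shift_apply (shift^[n] u) i with h | h <;> rcases ih (i - 1) with h' | h' <;>
      simp [h, h']

theorem iterate_shift_eq_zero {u : Fin 24 → ZMod 5} {n : ℕ} {i : Fin 24} :
    shift^[n] u i = 0 ↔ u (i - (n : Fin 24)) = 0 := by
  rcases iterate_shift_apply u n i with h | h <;> simp [h]

theorem sqz_shift (u : Fin 24 → ZMod 5) (i : Fin 24) : sqz (shift u i) = sqz (u (i - 1)) := by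
  rcases shift_apply u i with h | h <;> simp [h, sqz_neg]

theorem weight_shift (u : Fin 24 → ZMod 5) : weight (shift u) = weight u := by
  simp only [weight, sqz_shift]
  exact Equiv.sum_comp (Equiv.subRight (1 : Fin 24)) fun i => sqz (u i)

theorem evens_shift (u : Fin 24 → ZMod 5) : sqs (evens (shift u)) = sqs (odds u) := by
  simp only [sqs, evens, odds, List.map_cons, List.map_nil, List.sum_cons, List.sum_nil, sqz_shift]
  simp only [show (0 : Fin 24) - 1 = 23 from rfl, show (2 : Fin 24) - 1 = 1 from rfl,
    show (4 : Fin 24) - 1 = 3 from rfl, show (6 : Fin 24) - 1 = 5 from rfl,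
    show (8 : Fin 24) - 1 = 7 from rfl, show (10 : Fin 24) - 1 = 9 from rfl,
    show (12 : Fin 24) - 1 = 11 from rfl, show (14 : Fin 24) - 1 = 13 from rfl,
    show (16 : Fin 24) - 1 = 15 from rfl, show (18 : Fin 24) - 1 = 17 from rfl,
    show (20 : Fin 24) - 1 = 19 from rfl, show (22 : Fin 24) - 1 = 21 from rfl]
  ring

theorem odds_shift (u : Fin 24 → ZMod 5) : sqs (odds (shift u)) = sqs (evens u) := by
  have h1 := sqs_evens_add_odds u
  have h2 := sqs_evens_add_odds (shift u)
  rw [weight_shift, evens_shift] at h2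
  omega

theorem negMat_shift (i j : Fin 24) :
    (if i + 1 = 0 then -negMat (i + 1) j else negMat (i + 1) j) =
      if j = 0 then -negMat i (j - 1) else negMat i (j - 1) := by
  revert i j
  decide +kernel

theorem shift_vecMul (u : Fin 24 → ZMod 5) :
    Matrix.vecMul (shift u) negMat = shift (Matrix.vecMul u negMat) := by
  ext j
  have h : shift (Matrix.vecMul u negMat) j =
      ∑ i, u i * if j = 0 then -negMat i (j - 1) else negMat i (j - 1) := by
    unfold shift
    split <;> simp [Matrix.vecMul, dotProduct]
  rw [h, Matrix.vecMul, dotProduct, ← Equiv.sum_comp (Equiv.addRight (1 : Fin 24))]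
  refine Finset.sum_congr rfl fun i _ => ?_
  rw [← negMat_shift, Equiv.coe_addRight, shift, add_sub_cancel_right]
  split <;> simp

theorem heavy_shift {u : Fin 24 → ZMod 5} : Heavy (shift u) ↔ Heavy u := by
  simp [Heavy, shift_vecMul, weight_shift]

theorem weight_iterate_shift (u : Fin 24 → ZMod 5) (n : ℕ) : weight (shift^[n] u) = weight u := by
  induction n with
  | zero => rfl
  | succ n ih => rw [Function.iterate_succ_apply', weight_shift, ih]

theorem heavy_iterate_shift {u : Fin 24 → ZMod 5} {n : ℕ} : Heavy (shift^[n] u) ↔ Heavy u := by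
  induction n with
  | zero => rfl
  | succ n ih => rw [Function.iterate_succ_apply', heavy_shift, ih]

theorem evens_iterate_shift (u : Fin 24 → ZMod 5) (n : ℕ) :
    sqs (evens (shift^[2 * n] u)) = sqs (evens u) := by
  induction n with
  | zero => rfl
  | succ n ih =>
    rw [Nat.mul_succ, Function.iterate_succ_apply', Function.iterate_succ_apply', evens_shift,
      odds_shift, ih]

theorem exists_isolated {s : Finset (Fin 12)} (hs : s.Nonempty) (hc : s.card ≤ 5) :
    ∃ i ∈ s, i - 1 ∉ s ∧ i - 2 ∉ s := by
  by_contra! h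
  have key : ∀ i, i ∉ s → i + 1 ∈ s := by
    intro i hi
    by_contra hi'
    have : ∀ n : ℕ, i + (n : Fin 12) ∉ s ∧ i + (n : Fin 12) + 1 ∉ s := by
      intro n
      induction n with
      | zero => simpa using ⟨hi, hi'⟩
      | succ n ih =>
        push_cast
        rw [← add_assoc]
        refine ⟨ih.2, fun hm => ?_⟩
        have := h _ hm (by simpa using ih.2)
        rw [show i + (n : Fin 12) + 1 + 1 - 2 = i + (n : Fin 12) by
          rw [add_assoc (i + (n : Fin 12)), show (1 : Fin 12) + 1 = 2 from rfl,
            add_sub_cancel_right]] at this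
        exact ih.1 this
    obtain ⟨j, hj⟩ := hs
    have hj' := (this (j - i).val).1
    rw [Fin.cast_val_eq_self, add_sub_cancel] at hj'
    exact hj' hj
  have h1 : sᶜ.card ≤ s.card := Finset.card_le_card_of_injOn (· + 1)
    (fun i hi => key i (by simpa using hi)) ((add_left_injective 1).injOn)
  have h2 := s.card_add_card_compl
  rw [Fintype.card_fin] at h2
  omega

theorem heavy_of_evens_le {u : Fin 24 → ZMod 5} (h0 : u ≠ 0) (hu : weight u ≤ 10)
    (he : sqs (evens u) ≤ 5) : Heavy u := by
  have hev : sqs (evens u) = ∑ i : Fin 12, sqz (u (Fin.ofNat 24 (2 * i))) := by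
    simp [Fin.sum_univ_succ, sqs, evens]
  set s : Finset (Fin 12) := {i | u (Fin.ofNat 24 (2 * i)) ≠ 0} with hs
  have hcard : s.card ≤ sqs (evens u) := by
    rw [hev, Finset.card_eq_sum_ones]
    refine (Finset.sum_le_sum fun i hi => ?_).trans (Finset.sum_le_univ_sum_of_nonneg fun _ => by simp)
    exact Nat.one_le_iff_ne_zero.2 (mt sqz_eq_zero.1 (by simpa [hs] using hi))
  rcases s.eq_empty_or_nonempty with hs0 | hne
  · have hz : sqs (evens u) = 0 := by
      rw [hev, Finset.sum_eq_zero]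
      intro i _
      rw [sqz_eq_zero]
      by_contra hi
      have : i ∈ s := by simpa [hs] using hi
      simp [hs0] at this
    obtain ⟨i, hi⟩ := Function.ne_iff.1 h0
    have hodd : ∀ i : Fin 24, (∃ k : Fin 12, i = Fin.ofNat 24 (2 * k)) ∨
        ∃ k : Fin 12, 1 - ((2 * k.val : ℕ) : Fin 24) = i := by decide
    rcases hodd i with ⟨k, rfl⟩ | ⟨k, rfl⟩
    · have : k ∈ s := by simpa [hs] using hi
      simp [hs0] at this
    · rw [← heavy_iterate_shift (n := 2 * k.val)]
      refine heavy_of_evens_eq_zero ((weight_iterate_shift u _).trans_le hu)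
        ((evens_iterate_shift u _).trans hz) ?_
      rw [Ne, iterate_shift_eq_zero]
      exact hi
  · obtain ⟨i, hi, hi1, hi2⟩ := exists_isolated hne (hcard.trans he)
    obtain ⟨k, hk0, hk1, hk2⟩ : ∃ k : Fin 12,
        0 - ((2 * k.val : ℕ) : Fin 24) = Fin.ofNat 24 (2 * i) ∧
        22 - ((2 * k.val : ℕ) : Fin 24) = Fin.ofNat 24 (2 * (i - 1 : Fin 12)) ∧
        20 - ((2 * k.val : ℕ) : Fin 24) = Fin.ofNat 24 (2 * (i - 2 : Fin 12)) := by
      clear hi hi1 hi2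
      revert i; decide
    simp only [hs, Finset.mem_filter_univ, not_not] at hi hi1 hi2
    rw [← heavy_iterate_shift (n := 2 * k.val)]
    refine heavy_of_evens ((weight_iterate_shift u _).trans_le hu)
      ((evens_iterate_shift u _).trans_le he) ?_ ?_ ?_
    · rwa [Ne, iterate_shift_eq_zero, hk0]
    · rwa [iterate_shift_eq_zero, hk2]
    · rwa [iterate_shift_eq_zero, hk1]

end

theorem shift_ne_zero {u : Fin 24 → ZMod 5} (h : u ≠ 0) : shift u ≠ 0 := by
  obtain ⟨i, hi⟩ := Function.ne_iff.1 h
  refine Function.ne_iff.2 ⟨i + 1, fun h' => hi ?_⟩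
  rcases shift_apply u (i + 1) with e | e <;> rw [e] at h' <;> simpa using h'

theorem heavy_of_weight_le {u : Fin 24 → ZMod 5} (h0 : u ≠ 0) (hu : weight u ≤ 10) : Heavy u := by
  have h := sqs_evens_add_odds u
  rcases le_total (sqs (evens u)) (sqs (odds u)) with h1 | h1
  · exact heavy_of_evens_le h0 hu (by omega)
  · rw [← heavy_shift]
    exact heavy_of_evens_le (shift_ne_zero h0) ((weight_shift u).trans_le hu)
      (by rw [evens_shift]; omega)

theorem negMat_mul_transpose : negMat * negMat.transpose = -1 := by
  decide +kernel

/-- The signed permutation conjugating `negMat` to its transpose. -/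
def reflect (u : Fin 24 → ZMod 5) : Fin 24 → ZMod 5 := fun i => if i = 0 then u (-i) else -u (-i)

theorem weight_reflect (u : Fin 24 → ZMod 5) : weight (reflect u) = weight u := by
  have : ∀ i, sqz (reflect u i) = sqz (u (-i)) := fun i => by
    unfold reflect
    split <;> simp [sqz_neg]
  simp only [weight, this]
  exact Equiv.sum_comp (Equiv.neg (Fin 24)) fun i => sqz (u i)

theorem negMat_reflect (i j : Fin 24) :
    (if -i = 0 then negMat (-i) j else -negMat (-i) j) =
      if j = 0 then negMat (-j) i else -negMat (-j) i := by
  revert i j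
  decide +kernel

theorem reflect_vecMul (u : Fin 24 → ZMod 5) :
    Matrix.vecMul (reflect u) negMat = reflect (Matrix.vecMul u negMat.transpose) := by
  ext j
  have h : reflect (Matrix.vecMul u negMat.transpose) j =
      ∑ i, u i * if j = 0 then negMat (-j) i else -negMat (-j) i := by
    unfold reflect
    split <;> simp [Matrix.vecMul, dotProduct]
  rw [h, Matrix.vecMul, dotProduct, ← Equiv.sum_comp (Equiv.neg (Fin 24))]
  refine Finset.sum_congr rfl fun i _ => ?_
  rw [← negMat_reflect, Equiv.neg_apply, reflect, neg_neg]
  split <;> simp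

theorem heavy_of_ne_zero {u : Fin 24 → ZMod 5} (h0 : u ≠ 0) : Heavy u := by
  by_contra hlt
  have hu : ¬ weight u ≤ 10 := fun h => hlt (heavy_of_weight_le h0 h)
  have hv : Matrix.vecMul (Matrix.vecMul u negMat) negMat.transpose = -u := by
    rw [Matrix.vecMul_vecMul, negMat_mul_transpose, Matrix.vecMul_neg, Matrix.vecMul_one]
  set v := Matrix.vecMul u negMat with hvdef
  have hs : Heavy (reflect v) := by
    refine heavy_of_weight_le (fun h => ?_) ?_
    · have hw : weight v = 0 := by rw [← weight_reflect, h]; rfl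
      have : v = 0 := funext fun i => sqz_eq_zero.1 (Finset.sum_eq_zero_iff.1 hw i (Finset.mem_univ i))
      rw [this, Matrix.zero_vecMul] at hv
      exact h0 (neg_eq_zero.1 hv.symm)
    · rw [weight_reflect]
      have hlt' : ¬ 21 ≤ weight u + weight v := hlt
      omega
  rw [Heavy, reflect_vecMul, hv, weight_reflect, weight_reflect, weight_neg, add_comm] at hs
  exact hlt hs

section

variable {n : Type*} [Fintype n] [DecidableEq n]

/-- The code generated by the rows of `(I, A)`. -/
def doubleCode {ι : Type*} (e : n ⊕ n ≃ ι) (A : Matrix n n (ZMod 5)) :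
    Submodule (ZMod 5) (ι → ZMod 5) where
  carrier := {x | (fun j => x (e (.inr j))) = Matrix.vecMul (fun i => x (e (.inl i))) A}
  add_mem' {x y} hx hy := by
    exact (congrArg₂ (· + ·) hx hy).trans (Matrix.add_vecMul A _ _).symm
  zero_mem' := (Matrix.zero_vecMul A).symm
  smul_mem' a x hx := by
    exact (congrArg (a • ·) hx).trans (Matrix.smul_vecMul a _ A).symm

theorem isSelfDualCode_doubleCode {ι : Type*} [Fintype ι] (e : n ⊕ n ≃ ι)
    {A : Matrix n n (ZMod 5)} (hA : A * A.transpose = -1) : IsSelfDualCode (doubleCode e A) := by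
  have hsum (x y : ι → ZMod 5) : ∑ i, x i * y i =
      (fun i => x (e (.inl i))) ⬝ᵥ (fun i => y (e (.inl i))) +
        (fun i => x (e (.inr i))) ⬝ᵥ (fun i => y (e (.inr i))) := by
    rw [← e.sum_comp, Fintype.sum_sum_type]
    rfl
  have hA' : A.transpose * A = -1 := by
    have : -A * A.transpose = 1 := by rw [Matrix.neg_mul, hA, neg_neg]
    have := mul_eq_one_comm.1 this
    rw [Matrix.mul_neg] at this
    exact neg_eq_iff_eq_neg.1 this
  refine Set.Subset.antisymm (fun x hx y hy => ?_) fun x hx => ?_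
  · replace hx : (fun j => x (e (.inr j))) = _ := hx
    replace hy : (fun j => y (e (.inr j))) = _ := hy
    rw [hsum, hx, hy, ← Matrix.dotProduct_mulVec, ← Matrix.vecMul_transpose A,
      Matrix.vecMul_vecMul, hA, Matrix.vecMul_neg, Matrix.vecMul_one, dotProduct_neg,
      add_neg_cancel]
  · have key : (fun i => x (e (.inl i))) = -Matrix.mulVec A fun j => x (e (.inr j)) := by
      refine dotProduct_eq _ _ fun u => ?_
      have h := hx (fun k => Sum.elim u (Matrix.vecMul u A) (e.symm k)) (by
        change (fun j => _) = Matrix.vecMul (fun i => _) A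
        simp only [Equiv.symm_apply_apply, Sum.elim_inl, Sum.elim_inr])
      rw [hsum] at h
      simp only [Equiv.symm_apply_apply, Sum.elim_inl, Sum.elim_inr] at h
      rw [eq_neg_of_add_eq_zero_left h, neg_dotProduct, dotProduct_comm _ (Matrix.vecMul u A),
        ← Matrix.dotProduct_mulVec, dotProduct_comm u]
    change (fun j => x (e (.inr j))) = _
    rw [key, Matrix.neg_vecMul, ← Matrix.vecMul_transpose, Matrix.vecMul_vecMul, hA',
      Matrix.vecMul_neg, Matrix.vecMul_one, neg_neg]

end

section

variable {ι : Type*} [Fintype ι] (C : Submodule (ZMod 5) (ι → ZMod 5))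

/-- The Construction A lattice. -/
noncomputable def latticeA : Submodule ℤ (ι → ℝ) where
  carrier := constructionA 5 (C : Set (ι → ZMod 5))
  add_mem' := by
    rintro _ _ ⟨x, hx, rfl⟩ ⟨y, hy, rfl⟩
    refine ⟨x + y, ?_, ?_⟩
    · exact (funext fun i => (Int.cast_add (x i) (y i)).symm :
        (fun i => (x i : ZMod 5)) + (fun i => (y i : ZMod 5)) = _) ▸ C.add_mem hx hy
    · ext i
      simp [add_div]
  zero_mem' := ⟨0, (funext fun i => by simp : (fun i => ((0 : ι → ℤ) i : ZMod 5)) = 0) ▸ C.zero_mem, by ext i; simp⟩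
  smul_mem' := by
    rintro a _ ⟨x, hx, rfl⟩
    refine ⟨a • x, ?_, ?_⟩
    · exact (funext fun i => (Int.cast_mul a (x i)).symm :
        (a : ZMod 5) • (fun i => (x i : ZMod 5)) = _) ▸ C.smul_mem (a : ZMod 5) hx
    · ext i
      simp [mul_div_assoc]

variable {C}

theorem mem_latticeA {v : ι → ℝ} : v ∈ latticeA C ↔ ∃ x : ι → ℤ,
    (fun i => (x i : ZMod 5)) ∈ C ∧ v = fun i => (x i : ℝ) / √5 := by
  change (∃ _, _) ↔ _
  simp

theorem single_mem_latticeA [DecidableEq ι] (i : ι) : Pi.single i (√5) ∈ latticeA C := by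
  refine mem_latticeA.2 ⟨Pi.single i 5, ?_, ?_⟩
  · convert C.zero_mem using 1
    ext j
    rcases eq_or_ne j i with rfl | h
    · simp; rfl
    · simp [h]
  · ext j
    rcases eq_or_ne j i with rfl | h
    · simp
    · simp [h]

theorem isLatticeIn_latticeA : IsLatticeIn (latticeA C) := by
  classical
  have h5 : (0 : ℝ) < √5 := by positivity
  constructor
  · refine DiscreteTopology.of_forall_le_dist (r := 1 / √5) (by positivity) ?_
    rintro ⟨v, hv⟩ ⟨w, hw⟩ hne
    obtain ⟨x, -, rfl⟩ := mem_latticeA.1 hv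
    obtain ⟨y, -, rfl⟩ := mem_latticeA.1 hw
    obtain ⟨i, hi⟩ : ∃ i, x i ≠ y i := by
      by_contra! h
      exact hne (by simp [h])
    refine le_trans ?_ (dist_le_pi_dist _ _ i)
    rw [Real.dist_eq, ← sub_div, abs_div, abs_of_pos h5]
    gcongr
    exact_mod_cast Int.one_le_abs (sub_ne_zero.2 hi)
  · rw [eq_top_iff, ← (Pi.basisFun ℝ ι).span_eq, Submodule.span_le]
    rintro _ ⟨i, rfl⟩
    have := Submodule.smul_mem _ (√5)⁻¹
      (Submodule.subset_span (s := (latticeA C : Set (ι → ℝ))) (R := ℝ)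
        (single_mem_latticeA (C := C) i))
    rw [← Pi.single_smul, smul_eq_mul, inv_mul_cancel₀ h5.ne'] at this
    simpa using this

theorem five_dvd_of_intCast {z : ℤ} (h : (z : ZMod 5) = 0) : (5 : ℤ) ∣ z := by
  exact_mod_cast (ZMod.intCast_zmod_eq_zero_iff_dvd z 5).1 h

theorem ip_div_sqrt (x y : ι → ℤ) :
    ip (fun i => (x i : ℝ) / √5) (fun i => (y i : ℝ) / √5) = ((∑ i, x i * y i : ℤ) : ℝ) / 5 := by
  have h5 : √(5 : ℝ) * √5 = 5 := Real.mul_self_sqrt (by norm_num)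
  simp only [ip, div_mul_div_comm, h5, ← Finset.sum_div]
  push_cast
  rfl

theorem isUnimodularLattice_latticeA (hC : IsSelfDualCode C) :
    IsUnimodularLattice (latticeA C) := by
  classical
  have h5 : √(5 : ℝ) * √5 = 5 := Real.mul_self_sqrt (by norm_num)
  have hpos : (0 : ℝ) < √5 := by positivity
  refine Set.Subset.antisymm (fun v hv w hw => ?_) fun v hv => ?_
  · obtain ⟨x, hx, rfl⟩ := mem_latticeA.1 hv
    obtain ⟨y, hy, rfl⟩ := mem_latticeA.1 hw
    have hx : (fun i => (x i : ZMod 5)) ∈ dualCode C := hC ▸ hx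
    have h := hx _ hy
    obtain ⟨k, hk⟩ : (5 : ℤ) ∣ ∑ i, x i * y i := five_dvd_of_intCast (by push_cast; exact h)
    exact ⟨k, by rw [ip_div_sqrt, hk]; push_cast; ring⟩
  · have hz : ∀ i, ∃ z : ℤ, v i = z / √5 := fun i => by
      obtain ⟨z, hz⟩ := hv _ (single_mem_latticeA i)
      refine ⟨z, ?_⟩
      rw [eq_div_iff hpos.ne', ← hz]
      simp [ip, Pi.single_apply]
    choose z hz using hz
    obtain rfl : v = fun i => (z i : ℝ) / √5 := funext hz
    refine mem_latticeA.2 ⟨z, ?_, rfl⟩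
    change _ ∈ (C : Set (ι → ZMod 5))
    rw [hC]
    intro y hy
    obtain ⟨k, hk⟩ := hv _ (mem_latticeA.2 ⟨fun i => (y i).val, by simpa using hy, rfl⟩)
    rw [ip_div_sqrt, div_eq_iff (by norm_num)] at hk
    have hk : ∑ i, z i * ((y i).val : ℤ) = k * 5 := by exact_mod_cast hk
    have := congrArg (Int.cast : ℤ → ZMod 5) hk
    push_cast at this
    simpa [show (5 : ZMod 5) = 0 from rfl] using this

theorem sqz_intCast_le (z : ℤ) : (sqz z : ℤ) ≤ z * z := by
  have h := ZMod.val_intCast (n := 5) z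
  have hlt := ZMod.val_lt (z : ZMod 5)
  simp only [sqz, sqN]
  generalize (z : ZMod 5).val = r at *
  have hq := Int.emod_add_mul_ediv z 5
  push_cast at h
  rw [← h] at hq
  rcases le_or_gt 0 (z / 5) with h0 | h0
  · have : (r : ℤ) ≤ z := by omega
    have hm : ((min (r ^ 2) ((5 - r) ^ 2) : ℕ) : ℤ) ≤ (r : ℤ) ^ 2 := by
      exact_mod_cast min_le_left _ _
    nlinarith
  · have : (5 : ℤ) - r ≤ -z := by omega
    have hm : ((min (r ^ 2) ((5 - r) ^ 2) : ℕ) : ℤ) ≤ ((5 - r : ℕ) : ℤ) ^ 2 := by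
      exact_mod_cast min_le_right _ _
    rw [Nat.cast_sub hlt.le] at hm
    push_cast at hm
    have : (0 : ℤ) ≤ 5 - r := by omega
    push_cast
    nlinarith

theorem hasMinNorm_latticeA [Nonempty ι] (hC : IsSelfDualCode C)
    (h : ∀ c ∈ C, c ≠ 0 → 21 ≤ ∑ i, sqz (c i)) : HasMinNorm (latticeA C) 5 := by
  classical
  constructor
  · obtain ⟨i⟩ := ‹Nonempty ι›
    refine ⟨_, single_mem_latticeA i, ?_, ?_⟩
    · simp
    · simp [ip, Pi.single_apply]
  · rintro _ ⟨v, hv, hne, rfl⟩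
    obtain ⟨x, hx, rfl⟩ := mem_latticeA.1 hv
    rw [ip_div_sqrt, le_div_iff₀ (by norm_num)]
    suffices 25 ≤ ∑ i, x i * x i by
      have : ((25 : ℤ) : ℝ) ≤ ((∑ i, x i * x i : ℤ) : ℝ) := by exact_mod_cast this
      push_cast at this ⊢
      linarith
    by_cases h0 : (fun i => (x i : ZMod 5)) = 0
    · obtain ⟨i, hi⟩ : ∃ i, x i ≠ 0 := by
        by_contra! hz
        exact hne (by ext; simp [hz])
      have h1 : (5 : ℤ) ∣ x i := five_dvd_of_intCast (congrFun h0 i)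
      obtain ⟨k, hk⟩ := h1
      have hk0 : k ≠ 0 := by rintro rfl; simp [hk] at hi
      have : 1 ≤ k * k := Int.one_le_abs (mul_ne_zero hk0 hk0) |>.trans_eq (abs_mul_self k)
      calc (25 : ℤ) ≤ x i * x i := by rw [hk]; nlinarith
        _ ≤ ∑ i, x i * x i := Finset.single_le_sum (f := fun i => x i * x i)
            (fun j _ => mul_self_nonneg _) (Finset.mem_univ i)
    · have h1 := h _ hx h0
      have h2 : ((∑ i, sqz (x i) : ℕ) : ℤ) ≤ ∑ i, x i * x i := by
        push_cast
        exact Finset.sum_le_sum fun i _ => sqz_intCast_le _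
      have hx' : (fun i => (x i : ZMod 5)) ∈ dualCode C := hC ▸ hx
      have h3 : (5 : ℤ) ∣ ∑ i, x i * x i := five_dvd_of_intCast (by push_cast; exact hx' _ hx)
      omega

end

/-- a self-dual code of length 48 over 𝔽₅ whose Construction A lattice
is unimodular of minimum norm 5. -/
theorem exists_selfDual_F5_code_unimodular_min_norm_5 :
    ∃ C : Submodule (ZMod 5) (Fin 48 → ZMod 5), IsSelfDualCode C ∧
      ∃ L : Submodule ℤ (Fin 48 → ℝ),
        (L : Set (Fin 48 → ℝ)) = constructionA 5 (C : Set (Fin 48 → ZMod 5)) ∧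
        IsLatticeIn L ∧ IsUnimodularLattice L ∧ HasMinNorm L 5 := by
  have e : Fin 24 ⊕ Fin 24 ≃ Fin 48 := finSumFinEquiv
  have hC := isSelfDualCode_doubleCode e negMat_mul_transpose
  refine ⟨doubleCode e negMat, hC, latticeA _, rfl, isLatticeIn_latticeA,
    isUnimodularLattice_latticeA hC, hasMinNorm_latticeA hC fun c hc h0 => ?_⟩
  replace hc : (fun j => c (e (.inr j))) = _ := hc
  have hu : (fun i => c (e (.inl i))) ≠ 0 := fun hu => h0 <| by
    rw [hu, Matrix.zero_vecMul] at hc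
    ext k
    obtain ⟨i | i, rfl⟩ := e.surjective k
    · exact congrFun hu i
    · exact congrFun hc i
  have key := heavy_of_ne_zero hu
  rw [Heavy, ← hc] at key
  rwa [← e.sum_comp, Fintype.sum_sum_type]
end
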